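/- Let 1 ≤ p < ∞, m ∈ ℕ, a ∈ ℝ and 0 ≤ ℓ < d. Then ‖u‖_* := ‖ρ^{−a} u | L_p(ℝ^d)‖ + Σ_{|α|=m} ‖ρ^{m−a} ∂^α u | L_p(ℝ^d)‖ is an equivalent norm on 𝒦^m_{a,p}(ℝ^d,ℝ^ℓ_*); that is, there are constants 0 < c₁ ≤ c₂ such that c₁‖u‖ ≤ ‖u‖_* ≤ c₂‖u‖ for all u ∈ 𝒦^m_{a,p}(ℝ^d,ℝ^ℓ_*). -/

import Mathlib

open MeasureTheory Metric Set Filter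
open scoped Topology ENNReal NNReal

noncomputable section

/-- `d`-dimensional Euclidean space. -/
abbrev Ed (d : ℕ) : Type := EuclideanSpace ℝ (Fin d)

/-- The finite set of all multi-indices `α : Fin d → ℕ` with `|α| = ∑ i, α i ≤ m`. -/
def multiIdx (d m : ℕ) : Finset (Fin d → ℕ) :=
  (Fintype.piFinset fun _ : Fin d => Finset.range (m + 1)).filter fun α => ∑ i, α i ≤ m

/-- First-order partial derivative in the `i`-th coordinate direction. -/
def pderivI (d : ℕ) (i : Fin d) (f : Ed d → ℝ) : Ed d → ℝ :=
  fun x => fderiv ℝ f x (EuclideanSpace.single i 1)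

/-- Iterated partial derivative `∂^α`. -/
def pderivA (d : ℕ) (α : Fin d → ℕ) (f : Ed d → ℝ) : Ed d → ℝ :=
  ((List.finRange d).foldr (fun i g => (pderivI d i)^[α i] ∘ g) id) f

/-- Smooth compactly supported test functions with support inside `Ω`. -/
def IsTestFun (d : ℕ) (Ω : Set (Ed d)) (φ : Ed d → ℝ) : Prop :=
  ContDiff ℝ (⊤ : ℕ∞) φ ∧ HasCompactSupport φ ∧ tsupport φ ⊆ Ω

/-- `v` is the `α`-th weak (distributional) derivative of `u` on `Ω`. -/
def HasWeakDerivOn (d : ℕ) (Ω : Set (Ed d)) (α : Fin d → ℕ) (u v : Ed d → ℝ) : Prop :=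
  LocallyIntegrableOn u Ω volume ∧ LocallyIntegrableOn v Ω volume ∧
    ∀ φ : Ed d → ℝ, IsTestFun d Ω φ →
      ∫ x in Ω, u x * pderivA d α φ x = (-1 : ℝ) ^ (∑ i, α i) * ∫ x in Ω, v x * φ x

/-- `D` is a family of weak derivatives of `u` on `Ω` for all multi-indices of order `≤ m`. -/
def IsWeakDerivFamily (d : ℕ) (Ω : Set (Ed d)) (m : ℕ) (u : Ed d → ℝ)
    (D : (Fin d → ℕ) → Ed d → ℝ) : Prop :=
  ∀ α ∈ multiIdx d m, HasWeakDerivOn d Ω α u (D α)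

/-- `x ↦ (ρ(x)^(|α|-a) |v(x)|)^p`, the integrand in the Kondratiev norm. -/
def kIntegrand (d : ℕ) (ρ : Ed d → ℝ) (a p : ℝ) (α : Fin d → ℕ) (v : Ed d → ℝ) : Ed d → ℝ :=
  fun x => (ρ x ^ (((∑ i, α i : ℕ) : ℝ) - a) * |v x|) ^ p

/-- The Kondratiev norm computed from a family `D` of weak derivatives. -/
def KnormP (d : ℕ) (Ω : Set (Ed d)) (ρ : Ed d → ℝ) (m : ℕ) (a p : ℝ)
    (D : (Fin d → ℕ) → Ed d → ℝ) : ℝ :=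
  (∑ α ∈ multiIdx d m, ∫ x in Ω, kIntegrand d ρ a p α (D α) x) ^ (1 / p)

/-- `D` witnesses membership of `u` in the Kondratiev space `𝒦^m_{a,p}(Ω, M)`
    (with weight function `ρ`). -/
def KMemData (d : ℕ) (Ω : Set (Ed d)) (ρ : Ed d → ℝ) (m : ℕ) (a p : ℝ)
    (u : Ed d → ℝ) (D : (Fin d → ℕ) → Ed d → ℝ) : Prop :=
  IsWeakDerivFamily d Ω m u D ∧
    ∀ α ∈ multiIdx d m, IntegrableOn (kIntegrand d ρ a p α (D α)) Ω volume

/-- Membership in the Kondratiev space `𝒦^m_{a,p}(Ω, M)` with weight `ρ`, `p < ∞`. -/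
def MemK (d : ℕ) (Ω : Set (Ed d)) (ρ : Ed d → ℝ) (m : ℕ) (a p : ℝ) (u : Ed d → ℝ) : Prop :=
  ∃ D, KMemData d Ω ρ m a p u D

open Classical in
/-- The Kondratiev norm of `u` (computed from a choice of weak derivative family;
    it is a.e. independent of this choice). -/
def Knorm (d : ℕ) (Ω : Set (Ed d)) (ρ : Ed d → ℝ) (m : ℕ) (a p : ℝ) (u : Ed d → ℝ) : ℝ :=
  if h : MemK d Ω ρ m a p u then KnormP d Ω ρ m a p h.choose else 0

/-- `x ↦ ρ(x)^(|α|-a) v(x)`, the function whose `L_∞` norm enters the norm for `p = ∞`. -/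
def kIntegrandInf (d : ℕ) (ρ : Ed d → ℝ) (a : ℝ) (α : Fin d → ℕ) (v : Ed d → ℝ) : Ed d → ℝ :=
  fun x => ρ x ^ (((∑ i, α i : ℕ) : ℝ) - a) * v x

/-- `D` witnesses membership of `u` in `𝒦^m_{a,∞}(Ω, M)`. -/
def KMemDataInf (d : ℕ) (Ω : Set (Ed d)) (ρ : Ed d → ℝ) (m : ℕ) (a : ℝ)
    (u : Ed d → ℝ) (D : (Fin d → ℕ) → Ed d → ℝ) : Prop :=
  IsWeakDerivFamily d Ω m u D ∧
    ∀ α ∈ multiIdx d m,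
      eLpNorm (kIntegrandInf d ρ a α (D α)) ⊤ (volume.restrict Ω) < ⊤

/-- Membership in `𝒦^m_{a,∞}(Ω, M)`. -/
def MemKInf (d : ℕ) (Ω : Set (Ed d)) (ρ : Ed d → ℝ) (m : ℕ) (a : ℝ) (u : Ed d → ℝ) : Prop :=
  ∃ D, KMemDataInf d Ω ρ m a u D

/-- The `𝒦^m_{a,∞}` norm computed from a family `D` of weak derivatives. -/
def KnormInfP (d : ℕ) (Ω : Set (Ed d)) (ρ : Ed d → ℝ) (m : ℕ) (a : ℝ)
    (D : (Fin d → ℕ) → Ed d → ℝ) : ℝ :=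
  ∑ α ∈ multiIdx d m, (eLpNorm (kIntegrandInf d ρ a α (D α)) ⊤ (volume.restrict Ω)).toReal

open Classical in
/-- The `𝒦^m_{a,∞}(Ω, M)` norm of `u`. -/
def KnormInf (d : ℕ) (Ω : Set (Ed d)) (ρ : Ed d → ℝ) (m : ℕ) (a : ℝ) (u : Ed d → ℝ) : ℝ :=
  if h : MemKInf d Ω ρ m a u then KnormInfP d Ω ρ m a h.choose else 0

/-- The subspace `ℝ^ℓ_* = {x : x₁ = ⋯ = x_{d-ℓ} = 0}` of `ℝ^d`. -/
def RStar (d ℓ : ℕ) : Set (Ed d) := {x | ∀ i : Fin d, (i : ℕ) < d - ℓ → x i = 0}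

/-- The weight `ρ(x) = min(1, |x'|)` for the model case `(ℝ^d, ℝ^ℓ_*)`. -/
def rhoModel (d ℓ : ℕ) (x : Ed d) : ℝ :=
  min 1 (Real.sqrt (∑ i ∈ Finset.univ.filter (fun i : Fin d => (i : ℕ) < d - ℓ), (x i) ^ 2))

/-- The model domain `ℝ^d ∖ ℝ^ℓ_*`. -/
def ModelDomain (d ℓ : ℕ) : Set (Ed d) := (RStar d ℓ)ᶜ

/-- Membership in the model Kondratiev space `𝒦^m_{a,p}(ℝ^d, ℝ^ℓ_*)`, `p < ∞`. -/
def MemKM (d ℓ m : ℕ) (a p : ℝ) (u : Ed d → ℝ) : Prop :=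
  MemK d (ModelDomain d ℓ) (rhoModel d ℓ) m a p u

/-- The norm of the model Kondratiev space `𝒦^m_{a,p}(ℝ^d, ℝ^ℓ_*)`, `p < ∞`. -/
def KnormM (d ℓ m : ℕ) (a p : ℝ) (u : Ed d → ℝ) : ℝ :=
  Knorm d (ModelDomain d ℓ) (rhoModel d ℓ) m a p u

/-- Membership in the model Kondratiev space `𝒦^m_{a,∞}(ℝ^d, ℝ^ℓ_*)`. -/
def MemKMInf (d ℓ m : ℕ) (a : ℝ) (u : Ed d → ℝ) : Prop :=
  MemKInf d (ModelDomain d ℓ) (rhoModel d ℓ) m a u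

/-- The norm of the model Kondratiev space `𝒦^m_{a,∞}(ℝ^d, ℝ^ℓ_*)`. -/
def KnormMInf (d ℓ m : ℕ) (a : ℝ) (u : Ed d → ℝ) : ℝ :=
  KnormInf d (ModelDomain d ℓ) (rhoModel d ℓ) m a u

/-- The norm `‖u‖_* = ‖ρ^{-a}u|L_p‖ + ∑_{|α|=m} ‖ρ^{m-a}∂^α u|L_p‖`,
    computed from a weak derivative family `D` of `u`. -/
def KnormStarP (d : ℕ) (Ω : Set (Ed d)) (ρ : Ed d → ℝ) (m : ℕ) (a p : ℝ)
    (u : Ed d → ℝ) (D : (Fin d → ℕ) → Ed d → ℝ) : ℝ :=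
  (∫ x in Ω, (ρ x ^ (-a) * |u x|) ^ p) ^ (1 / p) +
    ∑ α ∈ (multiIdx d m).filter (fun α => ∑ i, α i = m),
      (∫ x in Ω, (ρ x ^ ((m : ℝ) - a) * |D α x|) ^ p) ^ (1 / p)


theorem smooth_pderivI {d : ℕ} (i : Fin d) {f : Ed d → ℝ} (hf : ContDiff ℝ (⊤ : ℕ∞) f) :
    ContDiff ℝ (⊤ : ℕ∞) (pderivI d i f) := by
  unfold pderivI
  have : ContDiff ℝ (⊤ : ℕ∞) (fderiv ℝ f) := hf.fderiv_right (by norm_cast)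
  exact this.clm_apply contDiff_const

theorem pderivI_comm {d : ℕ} (i j : Fin d) {f : Ed d → ℝ} (hf : ContDiff ℝ (⊤ : ℕ∞) f) :
    pderivI d i (pderivI d j f) = pderivI d j (pderivI d i f) := by
  have hd : Differentiable ℝ (fderiv ℝ f) := by
    have : ContDiff ℝ (⊤ : ℕ∞) (fderiv ℝ f) := hf.fderiv_right (by norm_cast)
    exact this.differentiable (by simp)
  have key : ∀ (k l : Fin d) (x : Ed d), pderivI d k (pderivI d l f) x =
      fderiv ℝ (fderiv ℝ f) x (EuclideanSpace.single k 1) (EuclideanSpace.single l 1) := by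
    intro k l x
    unfold pderivI
    rw [fderiv_clm_apply (hd x) (differentiableAt_const _)]
    simp
  funext x
  rw [key, key]
  have hs : IsSymmSndFDerivAt ℝ f x :=
    (hf.contDiffAt).isSymmSndFDerivAt (by
      simp only [minSmoothness_of_isRCLikeNormedField]; exact WithTop.coe_le_coe.2 (le_top : (2 : ℕ∞) ≤ ⊤))
  exact hs _ _

theorem smooth_iter {d : ℕ} (i : Fin d) (n : ℕ) {f : Ed d → ℝ}
    (hf : ContDiff ℝ (⊤ : ℕ∞) f) : ContDiff ℝ (⊤ : ℕ∞) ((pderivI d i)^[n] f) := by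
  induction n generalizing f with
  | zero => simpa using hf
  | succ n ih => rw [Function.iterate_succ_apply]; exact ih (smooth_pderivI i hf)

theorem iter_comm {d : ℕ} (i j : Fin d) (n : ℕ) {f : Ed d → ℝ}
    (hf : ContDiff ℝ (⊤ : ℕ∞) f) :
    (pderivI d j)^[n] (pderivI d i f) = pderivI d i ((pderivI d j)^[n] f) := by
  induction n generalizing f with
  | zero => rfl
  | succ n ih =>
    rw [Function.iterate_succ_apply, Function.iterate_succ_apply, pderivI_comm j i hf,
      ih (smooth_pderivI j hf)]

/-- Iterated partial derivative along a list of directions. -/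
def listD (d : ℕ) (l : List (Fin d)) (α : Fin d → ℕ) (f : Ed d → ℝ) : Ed d → ℝ :=
  (l.foldr (fun i g => (pderivI d i)^[α i] ∘ g) id) f

theorem listD_cons {d : ℕ} (j : Fin d) (l : List (Fin d)) (α : Fin d → ℕ) (f : Ed d → ℝ) :
    listD d (j :: l) α f = (pderivI d j)^[α j] (listD d l α f) := rfl

theorem smooth_listD {d : ℕ} (l : List (Fin d)) (α : Fin d → ℕ) {f : Ed d → ℝ}
    (hf : ContDiff ℝ (⊤ : ℕ∞) f) : ContDiff ℝ (⊤ : ℕ∞) (listD d l α f) := by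
  induction l with
  | nil => exact hf
  | cons j l ih => rw [listD_cons]; exact smooth_iter j _ ih

theorem listD_comm {d : ℕ} (i : Fin d) (l : List (Fin d)) (α : Fin d → ℕ) {f : Ed d → ℝ}
    (hf : ContDiff ℝ (⊤ : ℕ∞) f) :
    listD d l α (pderivI d i f) = pderivI d i (listD d l α f) := by
  induction l with
  | nil => rfl
  | cons j l ih => rw [listD_cons, listD_cons, ih, iter_comm i j _ (smooth_listD l α hf)]

theorem listD_add_not_mem {d : ℕ} (i : Fin d) (l : List (Fin d)) (hi : i ∉ l)
    (α : Fin d → ℕ) (f : Ed d → ℝ) :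
    listD d l (α + Pi.single i 1) f = listD d l α f := by
  induction l with
  | nil => rfl
  | cons j l ih =>
    simp only [List.mem_cons, not_or] at hi
    rw [listD_cons, listD_cons, ih hi.2]
    have : (α + Pi.single i 1 : Fin d → ℕ) j = α j := by simp [Pi.single_apply, Ne.symm hi.1]
    rw [this]

theorem listD_add_mem {d : ℕ} (i : Fin d) (l : List (Fin d)) (hn : l.Nodup) (hi : i ∈ l)
    (α : Fin d → ℕ) {f : Ed d → ℝ} (hf : ContDiff ℝ (⊤ : ℕ∞) f) :
    listD d l (α + Pi.single i 1) f = listD d l α (pderivI d i f) := by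
  induction l with
  | nil => simp at hi
  | cons j l ih =>
    rw [listD_cons, listD_cons]
    rw [List.nodup_cons] at hn
    by_cases hij : i = j
    · subst hij
      rw [listD_add_not_mem i l hn.1, listD_comm i l α hf]
      have : (α + Pi.single i 1 : Fin d → ℕ) i = α i + 1 := by simp
      rw [this, Function.iterate_succ_apply]
    · have hil : i ∈ l := by
        rcases List.mem_cons.1 hi with h | h
        · exact absurd h hij
        · exact h
      rw [ih hn.2 hil]
      have : (α + Pi.single i 1 : Fin d → ℕ) j = α j := by simp [Pi.single_apply, Ne.symm hij]
      rw [this]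

theorem pderivA_add_single {d : ℕ} (i : Fin d) (α : Fin d → ℕ) {f : Ed d → ℝ}
    (hf : ContDiff ℝ (⊤ : ℕ∞) f) :
    pderivA d (α + Pi.single i 1) f = pderivA d α (pderivI d i f) :=
  listD_add_mem i (List.finRange d) (List.nodup_finRange d) (List.mem_finRange i) α hf

theorem pderivA_zero {d : ℕ} (f : Ed d → ℝ) : pderivA d 0 f = f := by
  have : ∀ l : List (Fin d), listD d l 0 f = f := by
    intro l
    induction l with
    | nil => rfl
    | cons j l ih => rw [listD_cons, ih]; rfl
  exact this _

/-- First order weak derivative in the direction `i`. -/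
def W1 (d : ℕ) (Ω : Set (Ed d)) (i : Fin d) (g v : Ed d → ℝ) : Prop :=
  LocallyIntegrableOn g Ω volume ∧ LocallyIntegrableOn v Ω volume ∧
    ∀ φ : Ed d → ℝ, IsTestFun d Ω φ →
      ∫ x in Ω, g x * pderivI d i φ x = - ∫ x in Ω, v x * φ x

theorem testFun_pderivI {d : ℕ} {Ω : Set (Ed d)} (i : Fin d) {φ : Ed d → ℝ}
    (h : IsTestFun d Ω φ) : IsTestFun d Ω (pderivI d i φ) := by
  have hsub : tsupport (pderivI d i φ) ⊆ tsupport φ := by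
    refine closure_minimal ?_ (isClosed_tsupport φ)
    intro x hx
    by_contra hc
    apply hx
    have := fderiv_of_notMem_tsupport (𝕜 := ℝ) hc
    simp [pderivI, this]
  refine ⟨smooth_pderivI i h.1, ?_, hsub.trans h.2.2⟩
  exact h.2.1.of_isClosed_subset (isClosed_tsupport _) hsub

theorem W1_of_weak {d : ℕ} {Ω : Set (Ed d)} (i : Fin d) (α : Fin d → ℕ) {u g v : Ed d → ℝ}
    (hg : HasWeakDerivOn d Ω α u g) (hv : HasWeakDerivOn d Ω (α + Pi.single i 1) u v) :
    W1 d Ω i g v := by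
  refine ⟨hg.2.1, hv.2.1, fun φ hφ => ?_⟩
  have h1 := hg.2.2 _ (testFun_pderivI i hφ)
  have h2 := hv.2.2 φ hφ
  rw [pderivA_add_single i α hφ.1, h1] at h2
  have hs : ∑ k, (α + Pi.single i 1 : Fin d → ℕ) k = (∑ k, α k) + 1 := by
    simp [Finset.sum_add_distrib]
  rw [hs, pow_succ, mul_assoc] at h2
  have h3 := mul_left_cancel₀ (pow_ne_zero _ (by norm_num : (-1 : ℝ) ≠ 0)) h2
  rw [h3]; ring

theorem W1_congr {d : ℕ} {Ω : Set (Ed d)} (i : Fin d) {g v g' v' : Ed d → ℝ}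
    (hΩ : IsOpen Ω)
    (h : W1 d Ω i g v) (hg : g =ᵐ[volume.restrict Ω] g') (hv : v =ᵐ[volume.restrict Ω] v') :
    W1 d Ω i g' v' := by
  have hloc : ∀ {f f' : Ed d → ℝ}, LocallyIntegrableOn f Ω volume →
      f =ᵐ[volume.restrict Ω] f' → LocallyIntegrableOn f' Ω volume := by
    intro f f' hf hff
    rw [locallyIntegrableOn_iff hΩ.isLocallyClosed] at hf ⊢
    intro k hk hkc
    exact (hf k hk hkc).congr (ae_restrict_of_ae_restrict_of_subset hk hff)
  refine ⟨hloc h.1 hg, hloc h.2.1 hv, fun φ hφ => ?_⟩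
  have h1 : ∫ x in Ω, g x * pderivI d i φ x = ∫ x in Ω, g' x * pderivI d i φ x :=
    integral_congr_ae (hg.mono fun x hx => by simp only [hx])
  have h2 : ∫ x in Ω, v x * φ x = ∫ x in Ω, v' x * φ x :=
    integral_congr_ae (hv.mono fun x hx => by simp only [hx])
  rw [← h1, ← h2]
  exact h.2.2 φ hφ

theorem weak_zero_ae {d : ℕ} {Ω : Set (Ed d)} (hΩ : IsOpen Ω) {u v : Ed d → ℝ}
    (h : HasWeakDerivOn d Ω 0 u v) : u =ᵐ[volume.restrict Ω] v := by
  have hl : LocallyIntegrableOn (fun x => u x - v x) Ω volume := h.1.sub h.2.1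
  have := hΩ.ae_eq_zero_of_integral_contDiff_smul_eq_zero hl ?_
  · refine (ae_restrict_iff' hΩ.measurableSet).2 ?_
    filter_upwards [this] with x hx hxΩ
    linarith [hx hxΩ]
  · intro φ hφ hc hs
    have ht : IsTestFun d Ω φ := ⟨hφ, hc, hs⟩
    have := h.2.2 φ ht
    rw [pderivA_zero] at this
    simp only [Pi.zero_apply, Finset.sum_const_zero, pow_zero, one_mul] at this
    have hIntg : ∀ {f : Ed d → ℝ}, LocallyIntegrableOn f Ω volume →
        Integrable (fun x => f x * φ x) (volume.restrict Ω) := by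
      intro f hf
      have h1 : IntegrableOn f (tsupport φ) volume :=
        hf.integrableOn_compact_subset hs hc
      have h2 : IntegrableOn (fun x => f x * φ x) (tsupport φ) volume :=
        h1.mul_continuousOn hφ.continuous.continuousOn hc
      have h3 : Integrable (fun x => f x * φ x) volume := by
        refine (integrableOn_iff_integrable_of_support_subset ?_).1 h2
        intro x hx
        apply subset_tsupport
        intro h0; apply hx; simp [h0]
      exact h3.integrableOn
    have e : ∫ x, φ x • (u x - v x) = ∫ x in Ω, (u x * φ x - v x * φ x) := by
      rw [setIntegral_eq_integral_of_forall_compl_eq_zero]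
      · congr 1; ext x; simp; ring
      · intro x hx
        have : φ x = 0 := by
          by_contra h0
          exact hx (hs (subset_tsupport _ h0))
        simp [this]
    rw [e, integral_sub (hIntg h.1) (hIntg h.2.1), this, sub_self]


/-- Abstract properties of the weight. -/
structure GoodWeight (d : ℕ) (Ω : Set (Ed d)) (ρ : Ed d → ℝ) : Prop where
  nonneg : ∀ x, 0 ≤ ρ x
  lip : ∀ x y, ρ x ≤ ρ y + ‖x - y‖
  mem : ∀ x, x ∈ Ω ↔ 0 < ρ x

theorem GoodWeight.cont {d : ℕ} {Ω : Set (Ed d)} {ρ : Ed d → ℝ} (h : GoodWeight d Ω ρ) :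
    Continuous ρ := by
  have : LipschitzWith 1 ρ := by
    refine LipschitzWith.of_le_add fun x y => ?_
    rw [dist_eq_norm]; exact h.lip x y
  exact this.continuous

theorem GoodWeight.isOpen_dom {d : ℕ} {Ω : Set (Ed d)} {ρ : Ed d → ℝ} (h : GoodWeight d Ω ρ) :
    IsOpen Ω := by
  have : Ω = ρ ⁻¹' Ioi 0 := by ext x; simp [h.mem]
  rw [this]; exact isOpen_Ioi.preimage h.cont

/-- Mollification of `g`. -/
def cv {d : ℕ} (φ : ContDiffBump (0 : Ed d)) (g : Ed d → ℝ) (x : Ed d) : ℝ :=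
  ∫ t, φ.normed volume t * g (x - t)

theorem cv_eq_conv {d : ℕ} (φ : ContDiffBump (0 : Ed d)) (g : Ed d → ℝ) :
    cv φ g = convolution (φ.normed volume) g (ContinuousLinearMap.lsmul ℝ ℝ) volume := rfl

theorem normed_zero {d : ℕ} (φ : ContDiffBump (0 : Ed d)) {t : Ed d} (ht : φ.rOut ≤ ‖t‖) :
    φ.normed volume t = 0 := by
  by_contra h
  have : t ∈ Function.support (φ.normed (volume : Measure (Ed d))) := h
  rw [φ.support_normed_eq] at this
  simp at this
  linarith

theorem cv_local {d : ℕ} (φ : ContDiffBump (0 : Ed d)) {g g' : Ed d → ℝ} {x : Ed d}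
    (h : ∀ y, ‖x - y‖ < φ.rOut → g y = g' y) : cv φ g x = cv φ g' x := by
  unfold cv
  congr 1
  ext t
  by_cases ht : ‖t‖ < φ.rOut
  · rw [h (x - t) (by simpa using ht)]
  · rw [normed_zero φ (not_lt.1 ht)]; simp

theorem locInt_indicator {d : ℕ} {Ω : Set (Ed d)} {ρ : Ed d → ℝ} (h : GoodWeight d Ω ρ)
    {g : Ed d → ℝ} (hg : LocallyIntegrableOn g Ω volume) {k : ℝ} (hk : 0 < k) :
    LocallyIntegrable ({x | k ≤ ρ x}.indicator g) volume := by
  have hm : MeasurableSet {x | k ≤ ρ x} := (isClosed_le continuous_const h.cont).measurableSet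
  intro x
  by_cases hx : x ∈ Ω
  · have := hg x hx
    rw [h.isOpen_dom.nhdsWithin_eq hx] at this
    obtain ⟨s, hs, hi⟩ := this
    exact ⟨s, hs, hi.indicator hm⟩
  · have hx0 : ρ x < k := by
      have : ¬ 0 < ρ x := fun h' => hx ((h.mem x).2 h')
      linarith
    refine ⟨{y | ρ y < k}, (isOpen_lt h.cont continuous_const).mem_nhds hx0, ?_⟩
    refine (integrableOn_zero).congr_fun ?_ (isOpen_lt h.cont continuous_const).measurableSet
    intro y hy
    simp only [mem_ofPred_eq] at hy
    symm
    apply indicator_of_notMem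
    simp [hy]

theorem cv_hasDeriv {d : ℕ} {Ω : Set (Ed d)} {ρ : Ed d → ℝ} (h : GoodWeight d Ω ρ)
    (φ : ContDiffBump (0 : Ed d)) {i : Fin d} {g v : Ed d → ℝ} (hw : W1 d Ω i g v)
    (x : Ed d) (s : ℝ) (hx : φ.rOut < ρ (x + s • EuclideanSpace.single i 1)) :
    HasDerivAt (fun s : ℝ => cv φ g (x + s • EuclideanSpace.single i 1))
      (cv φ v (x + s • EuclideanSpace.single i 1)) s := by
  set e : Ed d := EuclideanSpace.single i 1 with he
  set y := x + s • e with hy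
  set η := φ.normed (volume : Measure (Ed d)) with hη
  set k := (ρ y - φ.rOut) / 2 with hk
  have hk0 : 0 < k := by rw [hk]; linarith
  set K : Set (Ed d) := {x | k ≤ ρ x} with hK
  have hG : LocallyIntegrable (K.indicator g) volume := locInt_indicator h hw.1 hk0
  have hηs : ContDiff ℝ (⊤ : ℕ∞) η := φ.contDiff_normed
  have hηc : HasCompactSupport η := φ.hasCompactSupport_normed
  have hF := hηc.hasFDerivAt_convolution_left (ContinuousLinearMap.lsmul ℝ ℝ)
    (hηs.of_le (by exact_mod_cast le_top)) hG y
  rw [← cv_eq_conv] at hF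
  have hball : ∀ z, ‖y - z‖ < φ.rOut + k → z ∈ K := by
    intro z hz
    have := h.lip y z
    simp only [hK, mem_ofPred_eq]
    linarith
  have hev : cv φ g =ᶠ[𝓝 y] cv φ (K.indicator g) := by
    filter_upwards [Metric.ball_mem_nhds y hk0] with y' hy'
    apply cv_local
    intro z hz
    rw [indicator_of_mem]
    apply hball
    rw [mem_ball, dist_comm, dist_eq_norm] at hy'
    calc ‖y - z‖ = ‖(y - y') + (y' - z)‖ := by congr 1; abel
      _ ≤ ‖y - y'‖ + ‖y' - z‖ := norm_add_le _ _
      _ < _ := by linarith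
  have hF2 := hF.congr_of_eventuallyEq hev
  have hline : HasDerivAt (fun s : ℝ => x + s • e) e s := by
    have := ((hasDerivAt_id s).smul_const e).const_add x
    simpa using this
  have hD := hF2.comp_hasDerivAt s hline
  refine hD.congr_deriv ?_
  -- compute the derivative
  have hex : ConvolutionExistsAt (fderiv ℝ η) (K.indicator g) y
      (ContinuousLinearMap.precompL (Ed d) (ContinuousLinearMap.lsmul ℝ ℝ)) volume :=
    (hηc.fderiv ℝ).convolutionExists_left _
      ((hηs.fderiv_right (m := 0) (by norm_cast)).continuous) hG y
  unfold convolution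
  rw [ContinuousLinearMap.integral_apply hex]
  have e1 : ∀ t, ((ContinuousLinearMap.precompL (Ed d) (ContinuousLinearMap.lsmul ℝ ℝ :
      ℝ →L[ℝ] ℝ →L[ℝ] ℝ)) (fderiv ℝ η t)) (K.indicator g (y - t)) e =
      pderivI d i η t * K.indicator g (y - t) := by
    intro t; simp [pderivI, ContinuousLinearMap.precompL_apply, he]
  simp only [e1]
  have e2 : ∫ t, pderivI d i η t * K.indicator g (y - t) =
      ∫ z, pderivI d i η (y - z) * K.indicator g z := by
    rw [← integral_sub_left_eq_self _ volume y]
    simp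
  rw [e2]
  set ψ : Ed d → ℝ := fun z => η (y - z) with hψ
  have hψ0 : ∀ z, ψ z ≠ 0 → ‖y - z‖ < φ.rOut := by
    intro z hz
    by_contra hc
    exact hz (normed_zero φ (not_lt.1 hc))
  have hts : tsupport ψ ⊆ closedBall y φ.rOut := by
    refine closure_minimal ?_ isClosed_closedBall
    intro z hz
    rw [mem_closedBall, dist_comm, dist_eq_norm]
    exact (hψ0 z hz).le
  have hKΩ : ∀ z, z ∈ K → z ∈ Ω := by
    intro z hz
    rw [h.mem]
    exact lt_of_lt_of_le hk0 hz
  have hcK : ∀ z ∈ closedBall y φ.rOut, z ∈ K := by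
    intro z hz
    rw [mem_closedBall, dist_comm, dist_eq_norm] at hz
    exact hball z (by linarith)
  have hT : IsTestFun d Ω ψ := by
    refine ⟨hηs.comp (contDiff_const.sub contDiff_id), ?_, fun z hz => hKΩ z (hcK z (hts hz))⟩
    exact (isCompact_closedBall y φ.rOut).of_isClosed_subset (isClosed_tsupport _) hts
  have hpψ : ∀ z, pderivI d i ψ z = - pderivI d i η (y - z) := by
    intro z
    have hd1 : HasFDerivAt η (fderiv ℝ η (y - z)) (y - z) :=
      ((hηs.differentiable (by simp)) _).hasFDerivAt
    have hd2 : HasFDerivAt (fun z : Ed d => y - z) (-(ContinuousLinearMap.id ℝ (Ed d))) z :=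
      (hasFDerivAt_id z).const_sub y
    have := (hd1.comp z hd2).fderiv
    unfold pderivI
    have e : ψ = η ∘ (fun z => y - z) := rfl
    rw [e, this]
    simp
  have hwk := hw.2.2 ψ hT
  have e3 : ∫ z, pderivI d i η (y - z) * K.indicator g z =
      - ∫ z in Ω, g z * pderivI d i ψ z := by
    rw [setIntegral_eq_integral_of_forall_compl_eq_zero, ← integral_neg]
    · congr 1
      ext z
      by_cases hz : z ∈ K
      · rw [indicator_of_mem hz, hpψ]; ring
      · have h0 : pderivI d i ψ z = 0 := by
          have hz' : z ∉ tsupport ψ := fun hc => hz (hcK z (hts hc))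
          have := fderiv_of_notMem_tsupport (𝕜 := ℝ) hz'
          simp [pderivI, this]
        rw [h0, indicator_of_notMem hz]; simp
    · intro z hz
      have hz' : z ∉ tsupport ψ := fun hc => hz (hT.2.2 hc)
      have := fderiv_of_notMem_tsupport (𝕜 := ℝ) hz'
      simp [pderivI, this]
  rw [e3, hwk, neg_neg, setIntegral_eq_integral_of_forall_compl_eq_zero]
  · unfold cv
    rw [← integral_sub_left_eq_self _ volume y]
    congr 1
    ext z
    simp [hψ, hη, mul_comm]
  · intro z hz
    have : ψ z = 0 := by
      by_contra hc
      exact hz (hT.2.2 (subset_tsupport _ hc))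
    simp [this]

theorem cv_tendsto {d : ℕ} {Ω : Set (Ed d)} {ρ : Ed d → ℝ} (h : GoodWeight d Ω ρ)
    {v : Ed d → ℝ} (hv : LocallyIntegrableOn v Ω volume)
    (φ : ℕ → ContDiffBump (0 : Ed d)) (h0 : Tendsto (fun n => (φ n).rOut) atTop (𝓝 0))
    (h2 : ∀ n, (φ n).rOut ≤ 2 * (φ n).rIn) :
    ∀ᵐ x, x ∈ Ω → Tendsto (fun n => cv (φ n) v x) atTop (𝓝 (v x)) := by
  have key : ∀ n : ℕ, ∀ᵐ x, Tendsto (fun k =>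
      cv (φ k) ({x | 1 / ((n : ℝ) + 1) ≤ ρ x}.indicator v) x) atTop
        (𝓝 (({x | 1 / ((n : ℝ) + 1) ≤ ρ x}.indicator v) x)) := by
    intro n
    exact ContDiffBump.ae_convolution_tendsto_right_of_locallyIntegrable h0
      (Eventually.of_forall h2) (locInt_indicator h hv (by positivity))
  filter_upwards [ae_all_iff.2 key] with x hx hxΩ
  have hpos := (h.mem x).1 hxΩ
  obtain ⟨n, hn⟩ := exists_nat_one_div_lt (half_pos hpos)
  have := hx n
  rw [indicator_of_mem (by simp only [mem_ofPred_eq]; linarith)] at this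
  refine this.congr' ?_
  filter_upwards [h0.eventually (gt_mem_nhds (half_pos hpos))] with k hk
  apply cv_local
  intro y hy
  rw [indicator_of_mem]
  have := h.lip x y
  simp only [mem_ofPred_eq]
  linarith


theorem jensen_lint {X : Type*} [MeasurableSpace X] {μ : Measure X} {f : X → ℝ≥0∞} {p : ℝ}
    (hp : 1 ≤ p) (hf : AEMeasurable f μ) :
    (∫⁻ x, f x ∂μ) ^ p ≤ (μ univ) ^ (p - 1) * ∫⁻ x, f x ^ p ∂μ := by
  have hp0 : 0 < p := by linarith
  have := eLpNorm'_le_eLpNorm'_mul_rpow_measure_univ (p := 1) (q := p) (μ := μ) (f := f)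
    one_pos hp hf.aestronglyMeasurable
  simp only [eLpNorm'_eq_lintegral_enorm, enorm_eq_self, ENNReal.rpow_one, div_one] at this
  calc (∫⁻ x, f x ∂μ) ^ p ≤ ((∫⁻ x, f x ^ p ∂μ) ^ (1 / p) * μ univ ^ (1 - 1 / p)) ^ p := by
        gcongr
    _ = _ := by
      rw [ENNReal.mul_rpow_of_nonneg _ _ hp0.le, ← ENNReal.rpow_mul, ← ENNReal.rpow_mul,
        one_div_mul_cancel hp0.ne', ENNReal.rpow_one, mul_comm]
      congr 2
      field_simp

theorem min_avg {F : ℝ → ℝ} {a r : ℝ} (hr : 0 < r) (hF : ContinuousOn F (Icc a (a + r))) :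
    ∃ σ ∈ Icc a (a + r), ENNReal.ofReal r * ‖F σ‖ₑ ≤ ∫⁻ s in Icc a (a + r), ‖F s‖ₑ := by
  obtain ⟨σ, hσ, hmin⟩ := isCompact_Icc.exists_isMinOn
    (nonempty_Icc.2 (by linarith : a ≤ a + r)) hF.norm
  refine ⟨σ, hσ, ?_⟩
  calc ENNReal.ofReal r * ‖F σ‖ₑ = ∫⁻ s in Icc a (a + r), ‖F σ‖ₑ := by
        rw [setLIntegral_const, Real.volume_Icc, mul_comm]; congr 2; ring
    _ ≤ _ := by
      refine setLIntegral_mono' measurableSet_Icc fun s hs => ?_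
      have := hmin hs
      simp only [mem_ofPred_eq] at this
      exact enorm_le_iff_norm_le.2 this

theorem one_dim {F f w : ℝ → ℝ} {r : ℝ} (hr : 0 < r)
    (hF : ∀ s ∈ Icc 0 (3 * r), HasDerivAt F (f s) s)
    (hf : ∀ s ∈ Icc 0 (3 * r), HasDerivAt f (w s) s) :
    ‖f 0‖ₑ ≤ ENNReal.ofReal (2 / r ^ 2) * (∫⁻ s in Icc 0 (3 * r), ‖F s‖ₑ) +
      ∫⁻ s in Icc 0 (3 * r), ‖w s‖ₑ := by
  have hFc : ContinuousOn F (Icc 0 (3 * r)) :=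
    fun s hs => (hF s hs).continuousAt.continuousWithinAt
  obtain ⟨σ, hσ, h1⟩ := min_avg (F := F) (a := 0) hr
    (hFc.mono (Icc_subset_Icc le_rfl (by linarith)))
  obtain ⟨τ, hτ, h2⟩ := min_avg (F := F) (a := 2 * r) hr
    (hFc.mono (Icc_subset_Icc (by linarith) (by linarith)))
  have h1' : ENNReal.ofReal r * ‖F σ‖ₑ ≤ ∫⁻ s in Icc 0 (3 * r), ‖F s‖ₑ :=
    h1.trans (lintegral_mono_set (Icc_subset_Icc le_rfl (by linarith)))
  have h2' : ENNReal.ofReal r * ‖F τ‖ₑ ≤ ∫⁻ s in Icc 0 (3 * r), ‖F s‖ₑ :=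
    h2.trans (lintegral_mono_set (Icc_subset_Icc (by linarith) (by linarith)))
  simp only [mem_Icc, zero_add] at hσ hτ
  have hστ : σ < τ := by linarith
  obtain ⟨ξ, hξ, hs⟩ := exists_hasDerivAt_eq_slope F f hστ
    (hFc.mono (Icc_subset_Icc (by linarith) (by linarith)))
    (fun s hs => hF s ⟨by linarith [hs.1], by linarith [hs.2]⟩)
  have hξ0 : 0 < ξ := by linarith [hξ.1]
  have hξ3 : ξ ≤ 3 * r := by linarith [hξ.2]
  -- bound at ξ
  have hfξ : ‖f ξ‖ₑ ≤ ENNReal.ofReal (2 / r ^ 2) * ∫⁻ s in Icc 0 (3 * r), ‖F s‖ₑ := by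
    have hb : ‖f ξ‖ ≤ (1 / r) * (‖F σ‖ + ‖F τ‖) := by
      rw [hs, norm_div, Real.norm_of_nonneg (by linarith : 0 ≤ τ - σ), div_eq_mul_inv,
        mul_comm, one_div]
      gcongr
      · linarith
      · rw [add_comm]; exact norm_sub_le _ _
    have hr2 : ENNReal.ofReal (2 / r ^ 2) = ENNReal.ofReal (1 / r ^ 2) + ENNReal.ofReal (1 / r ^ 2) := by
      rw [← ENNReal.ofReal_add (by positivity) (by positivity)]; congr 1; ring
    have hone : ENNReal.ofReal (1 / r) = ENNReal.ofReal (1 / r ^ 2) * ENNReal.ofReal r := by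
      rw [← ENNReal.ofReal_mul (by positivity)]; congr 1; field_simp
    calc ‖f ξ‖ₑ ≤ ENNReal.ofReal ((1 / r) * (‖F σ‖ + ‖F τ‖)) := by
          rw [← ofReal_norm]; exact ENNReal.ofReal_le_ofReal hb
      _ = ENNReal.ofReal (1 / r) * (‖F σ‖ₑ + ‖F τ‖ₑ) := by
          rw [ENNReal.ofReal_mul (by positivity), ENNReal.ofReal_add (by positivity) (by positivity),
            ofReal_norm, ofReal_norm]
      _ = ENNReal.ofReal (1 / r ^ 2) * (ENNReal.ofReal r * ‖F σ‖ₑ) +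
          ENNReal.ofReal (1 / r ^ 2) * (ENNReal.ofReal r * ‖F τ‖ₑ) := by rw [hone]; ring
      _ ≤ _ := by rw [hr2, add_mul]; gcongr
  by_cases hB : ∫⁻ s in Icc 0 (3 * r), ‖w s‖ₑ = ⊤
  · rw [hB]; simp
  have hwm : AEStronglyMeasurable w (volume.restrict (Icc 0 (3 * r))) := by
    refine (stronglyMeasurable_deriv f).aestronglyMeasurable.congr ?_
    refine (ae_restrict_iff' measurableSet_Icc).2 (Eventually.of_forall fun s hs => ?_)
    exact (hf s hs).deriv
  have hwi : IntegrableOn w (Icc 0 (3 * r)) volume :=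
    ⟨hwm, by unfold HasFiniteIntegral; exact lt_top_iff_ne_top.2 hB⟩
  have hsub : Icc 0 ξ ⊆ Icc 0 (3 * r) := Icc_subset_Icc le_rfl hξ3
  have hftc := intervalIntegral.integral_eq_sub_of_hasDerivAt (f := f) (f' := w) (a := 0) (b := ξ)
    (fun s hs => hf s (hsub (by rwa [uIcc_of_le hξ0.le] at hs)))
    ((intervalIntegrable_iff_integrableOn_Icc_of_le hξ0.le).2 (hwi.mono_set hsub))
  rw [intervalIntegral.integral_of_le hξ0.le] at hftc
  have hle : ‖f ξ - f 0‖ₑ ≤ ∫⁻ s in Icc 0 (3 * r), ‖w s‖ₑ := by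
    rw [← hftc]
    exact (enorm_integral_le_lintegral_enorm _).trans
      (lintegral_mono_set (Ioc_subset_Icc_self.trans hsub))
  calc ‖f 0‖ₑ = ‖f ξ - (f ξ - f 0)‖ₑ := by congr 1; ring
    _ ≤ ‖f ξ‖ₑ + ‖f ξ - f 0‖ₑ := enorm_sub_le
    _ ≤ _ := add_le_add hfξ hle

theorem lint_normed {d : ℕ} (φ : ContDiffBump (0 : Ed d)) :
    ∫⁻ t, ENNReal.ofReal (φ.normed volume t) = 1 := by
  rw [← ofReal_integral_eq_lintegral_ofReal φ.integrable_normed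
    (Eventually.of_forall fun t => φ.nonneg_normed t), φ.integral_normed]
  simp

theorem cv_rpow_le {d : ℕ} (φ : ContDiffBump (0 : Ed d)) {g : Ed d → ℝ} (hg : Measurable g)
    {p : ℝ} (hp : 1 ≤ p) (y : Ed d) :
    ‖cv φ g y‖ₑ ^ p ≤ ∫⁻ t, ENNReal.ofReal (φ.normed volume t) * ‖g (y - t)‖ₑ ^ p := by
  have hη : Measurable fun t : Ed d => ENNReal.ofReal (φ.normed volume t) :=
    (φ.continuous_normed.measurable).ennreal_ofReal
  have hgm : Measurable fun t => ‖g (y - t)‖ₑ := (hg.comp (measurable_const.sub measurable_id)).enorm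
  have h1 : ‖cv φ g y‖ₑ ≤ ∫⁻ t, ‖g (y - t)‖ₑ ∂(volume.withDensity
      fun t : Ed d => ENNReal.ofReal (φ.normed volume t)) := by
    rw [lintegral_withDensity_eq_lintegral_mul _ hη hgm]
    refine (enorm_integral_le_lintegral_enorm _).trans (lintegral_mono fun t => ?_)
    simp only [Pi.mul_apply]
    rw [enorm_mul, Real.enorm_of_nonneg (φ.nonneg_normed t)]
  have h2 := jensen_lint (p := p) hp (μ := volume.withDensity
      fun t : Ed d => ENNReal.ofReal (φ.normed volume t)) hgm.aemeasurable
  rw [lintegral_withDensity_eq_lintegral_mul _ hη (hgm.pow_const p), withDensity_apply _ MeasurableSet.univ,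
    Measure.restrict_univ, lint_normed, ENNReal.one_rpow, one_mul] at h2
  calc ‖cv φ g y‖ₑ ^ p ≤ _ := ENNReal.rpow_le_rpow h1 (by linarith)
    _ ≤ _ := h2

/-- The averaged function. -/
def Jav {d : ℕ} (φ : ContDiffBump (0 : Ed d)) (e : Ed d) (p r : ℝ) (h : Ed d → ℝ) (x : Ed d) :
    ℝ≥0∞ :=
  ENNReal.ofReal (1 / r) * ∫⁻ s in Icc 0 (3 * r),
    ∫⁻ t, ENNReal.ofReal (φ.normed volume t) * ‖h (x + s • e - t)‖ₑ ^ p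

theorem cv_measurable {d : ℕ} (φ : ContDiffBump (0 : Ed d)) {g : Ed d → ℝ} (hg : Measurable g) :
    Measurable (cv φ g) := by
  have : StronglyMeasurable fun z : Ed d × Ed d => φ.normed volume z.2 * g (z.1 - z.2) := by
    apply Measurable.stronglyMeasurable
    exact (φ.continuous_normed.measurable.comp measurable_snd).mul
      (hg.comp (measurable_fst.sub measurable_snd))
  exact this.integral_prod_right'.measurable

theorem seg_rpow_le {d : ℕ} (φ : ContDiffBump (0 : Ed d)) {g : Ed d → ℝ} (hg : Measurable g)
    {p : ℝ} (hp : 1 ≤ p) (x e : Ed d) {r : ℝ} (hr : 0 < r) :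
    (∫⁻ s in Icc 0 (3 * r), ‖cv φ g (x + s • e)‖ₑ) ^ p ≤
      ENNReal.ofReal (3 ^ (p - 1) * r ^ p) * Jav φ e p r g x := by
  have hm : Measurable fun s : ℝ => ‖cv φ g (x + s • e)‖ₑ :=
    ((cv_measurable φ hg).comp (by fun_prop)).enorm
  refine (jensen_lint hp hm.aemeasurable).trans ?_
  unfold Jav
  rw [Measure.restrict_apply_univ, Real.volume_Icc, ← mul_assoc,
    ← ENNReal.ofReal_mul (by positivity), ENNReal.ofReal_rpow_of_nonneg (by linarith) (by linarith)]
  have : (3 * r - 0) ^ (p - 1) = 3 ^ (p - 1) * r ^ p * (1 / r) := by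
    rw [sub_zero, Real.mul_rpow (by norm_num) hr.le, Real.rpow_sub hr, Real.rpow_one]
    ring
  rw [this]
  gcongr with s
  exact cv_rpow_le φ hg hp _

theorem pointwise_est {d : ℕ} {Ω : Set (Ed d)} {ρ : Ed d → ℝ} (h : GoodWeight d Ω ρ)
    (φ : ContDiffBump (0 : Ed d)) {i : Fin d} {g v w : Ed d → ℝ}
    (hg : Measurable g) (hw : Measurable w)
    (h1 : W1 d Ω i g v) (h2 : W1 d Ω i v w) {p : ℝ} (hp : 1 ≤ p)
    (x : Ed d) {r : ℝ} (hr : 0 < r) (hx : φ.rOut + 3 * r < ρ x) :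
    ‖cv φ v x‖ₑ ^ p ≤ ENNReal.ofReal (12 ^ p) *
      (ENNReal.ofReal (r ^ (-p)) * Jav φ (EuclideanSpace.single i 1) p r g x +
       ENNReal.ofReal (r ^ p) * Jav φ (EuclideanSpace.single i 1) p r w x) := by
  set e : Ed d := EuclideanSpace.single i 1 with he
  have hen : ‖e‖ = 1 := by simp [he]
  have hin : ∀ s ∈ Icc 0 (3 * r), φ.rOut < ρ (x + s • e) := by
    intro s hs
    have := h.lip x (x + s • e)
    have h' : ‖x - (x + s • e)‖ = s := by
      rw [sub_add_cancel_left, norm_neg, norm_smul, hen, mul_one, Real.norm_of_nonneg hs.1]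
    rw [h'] at this
    linarith [hs.2]
  have := one_dim (F := fun s => cv φ g (x + s • e)) (f := fun s => cv φ v (x + s • e))
    (w := fun s => cv φ w (x + s • e)) hr
    (fun s hs => cv_hasDeriv h φ h1 x s (hin s hs)) (fun s hs => cv_hasDeriv h φ h2 x s (hin s hs))
  simp only [zero_smul, add_zero] at this
  have hp0 : 0 ≤ p := by linarith
  refine (ENNReal.rpow_le_rpow this hp0).trans ?_
  refine (ENNReal.rpow_add_le_mul_rpow_add_rpow _ _ hp).trans ?_
  rw [ENNReal.mul_rpow_of_nonneg _ _ hp0]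
  have hA := seg_rpow_le φ hg hp x e hr
  have hB := seg_rpow_le φ hw hp x e hr
  have c2 : (2 : ℝ≥0∞) ^ (p - 1) = ENNReal.ofReal (2 ^ (p - 1)) := by
    rw [← ENNReal.ofReal_rpow_of_pos (by norm_num)]; norm_num
  have k1 : (2 : ℝ) ^ (p - 1) ≤ 2 ^ p := Real.rpow_le_rpow_of_exponent_le (by norm_num) (by linarith)
  have k2 : (3 : ℝ) ^ (p - 1) ≤ 3 ^ p := Real.rpow_le_rpow_of_exponent_le (by norm_num) (by linarith)
  have k3 : (1 : ℝ) ≤ 2 ^ p := Real.one_le_rpow (by norm_num) hp0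
  have k4 : (12 : ℝ) ^ p = 2 ^ p * 2 ^ p * 3 ^ p := by
    rw [← Real.mul_rpow (by norm_num) (by norm_num), ← Real.mul_rpow (by norm_num) (by norm_num)]
    norm_num
  have k5 : (2 / r ^ 2) ^ p * r ^ p = 2 ^ p * r ^ (-p) := by
    rw [← Real.mul_rpow (by positivity) hr.le, Real.rpow_neg hr.le, ← Real.inv_rpow hr.le,
      ← Real.mul_rpow (by norm_num) (by positivity)]
    congr 1
    field_simp
  rw [mul_add, mul_add, c2, ENNReal.ofReal_rpow_of_nonneg (by positivity) hp0]
  refine add_le_add ?_ ?_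
  · refine (mul_le_mul_right (mul_le_mul_right hA _) _).trans ?_
    rw [← mul_assoc, ← mul_assoc, ← mul_assoc, ← ENNReal.ofReal_mul (by positivity),
      ← ENNReal.ofReal_mul (by positivity), ← ENNReal.ofReal_mul (by positivity)]
    refine mul_le_mul_left (ENNReal.ofReal_le_ofReal ?_) _
    calc (2 : ℝ) ^ (p - 1) * (2 / r ^ 2) ^ p * (3 ^ (p - 1) * r ^ p)
        = 2 ^ (p - 1) * 3 ^ (p - 1) * ((2 / r ^ 2) ^ p * r ^ p) := by ring
      _ = 2 ^ (p - 1) * 2 ^ p * 3 ^ (p - 1) * r ^ (-p) := by rw [k5]; ring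
      _ ≤ 12 ^ p * r ^ (-p) := by rw [k4]; gcongr
  · refine (mul_le_mul_right hB _).trans ?_
    rw [← mul_assoc, ← mul_assoc, ← ENNReal.ofReal_mul (by positivity),
      ← ENNReal.ofReal_mul (by positivity)]
    refine mul_le_mul_left (ENNReal.ofReal_le_ofReal ?_) _
    calc (2 : ℝ) ^ (p - 1) * (3 ^ (p - 1) * r ^ p)
        = 2 ^ (p - 1) * 1 * 3 ^ (p - 1) * r ^ p := by ring
      _ ≤ 12 ^ p * r ^ p := by rw [k4]; gcongr


theorem rpow_comparable {a b : ℝ} (q : ℝ) (ha : 0 < a) (hb : 0 < b) (h1 : a ≤ 2 * b)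
    (h2 : b ≤ 2 * a) : a ^ q ≤ 2 ^ |q| * b ^ q := by
  rcases le_total 0 q with hq | hq
  · rw [abs_of_nonneg hq, ← Real.mul_rpow (by norm_num) hb.le]
    exact Real.rpow_le_rpow ha.le h1 hq
  · rw [abs_of_nonpos hq, Real.rpow_neg (by norm_num), ← Real.inv_rpow (by norm_num),
      ← Real.mul_rpow (by norm_num) hb.le]
    exact Real.rpow_le_rpow_of_nonpos (by positivity) (by linarith) hq

/-- The majorising kernel. -/
def kap {d : ℕ} (ρ : Ed d → ℝ) (ε q : ℝ) (z : ℝ × Ed d) : ℝ≥0∞ :=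
  {z : ℝ × Ed d | 0 < ρ z.2 ∧ z.1 ∈ Icc 0 (6 * (ε * ρ z.2))}.indicator
    (fun z => ENNReal.ofReal (2 ^ |q - 1| * ρ z.2 ^ (q - 1) * (1 / ε))) z

theorem kap_measurable {d : ℕ} {Ω : Set (Ed d)} {ρ : Ed d → ℝ} (h : GoodWeight d Ω ρ)
    (ε q : ℝ) : Measurable (kap ρ ε q) := by
  have hρ : Measurable fun z : ℝ × Ed d => ρ z.2 := h.cont.measurable.comp measurable_snd
  refine Measurable.indicator ?_ ?_
  · exact (((hρ.pow_const (q - 1)).const_mul _).mul_const _).ennreal_ofReal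
  · refine MeasurableSet.inter (measurableSet_lt measurable_const hρ) ?_
    exact MeasurableSet.inter (measurableSet_le measurable_const measurable_fst)
      (measurableSet_le measurable_fst ((hρ.const_mul ε).const_mul 6))

theorem kap_lintegral {d : ℕ} {Ω : Set (Ed d)} {ρ : Ed d → ℝ} (h : GoodWeight d Ω ρ)
    {ε q : ℝ} (hε : 0 < ε) (y : Ed d) :
    ∫⁻ s, kap ρ ε q (s, y) =
      Ω.indicator (fun y => ENNReal.ofReal (6 * 2 ^ |q - 1|) * ENNReal.ofReal (ρ y ^ q)) y := by
  by_cases hy : 0 < ρ y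
  · rw [indicator_of_mem ((h.mem y).2 hy)]
    have : ∀ s, kap ρ ε q (s, y) = (Icc 0 (6 * (ε * ρ y))).indicator
        (fun _ => ENNReal.ofReal (2 ^ |q - 1| * ρ y ^ (q - 1) * (1 / ε))) s := by
      intro s
      unfold kap
      by_cases hs : s ∈ Icc 0 (6 * (ε * ρ y))
      · rw [indicator_of_mem hs, indicator_of_mem]; exact ⟨hy, hs⟩
      · rw [indicator_of_notMem hs, indicator_of_notMem]; exact fun hc => hs hc.2
    simp only [this]
    rw [lintegral_indicator measurableSet_Icc, setLIntegral_const, Real.volume_Icc,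
      ← ENNReal.ofReal_mul (by positivity), ← ENNReal.ofReal_mul (by positivity)]
    congr 1
    rw [Real.rpow_sub hy, Real.rpow_one]
    field_simp
    ring
  · rw [indicator_of_notMem (fun hc => hy ((h.mem y).1 hc))]
    have : ∀ s, kap ρ ε q (s, y) = 0 := by
      intro s
      unfold kap
      rw [indicator_of_notMem]; exact fun hc => hy hc.1
    simp [this]

theorem kap_ge {d : ℕ} {Ω : Set (Ed d)} {ρ : Ed d → ℝ} (h : GoodWeight d Ω ρ)
    {ε q δ : ℝ} (hε : 0 < ε) (hε8 : ε ≤ 1 / 8) {e : Ed d} (he : ‖e‖ = 1) {x t : Ed d} {s : ℝ}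
    (hx : δ < ε * ρ x) (ht : ‖t‖ < δ) (hs : s ∈ Icc 0 (3 * (ε * ρ x))) :
    ENNReal.ofReal (ρ x ^ q) * ENNReal.ofReal (1 / (ε * ρ x)) ≤ kap ρ ε q (s, x + s • e - t) := by
  set y := x + s • e - t with hy
  have hδ : 0 < δ := lt_of_le_of_lt (norm_nonneg t) ht
  have hρx : 0 < ρ x := by
    by_contra hc
    have : ε * ρ x ≤ 0 := mul_nonpos_of_nonneg_of_nonpos hε.le (not_lt.1 hc)
    linarith
  have hn : ‖x - y‖ ≤ s + ‖t‖ := by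
    have : x - y = -(s • e) + t := by rw [hy]; abel
    rw [this]
    refine (norm_add_le _ _).trans ?_
    rw [norm_neg, norm_smul, he, mul_one, Real.norm_of_nonneg hs.1]
  have hn2 : ‖x - y‖ ≤ ρ x / 2 := by
    have : ε * ρ x ≤ 1 / 8 * ρ x := by gcongr
    linarith [hs.2]
  have l1 := h.lip x y
  have l2 := h.lip y x
  rw [norm_sub_rev] at l2
  have hρy : 0 < ρ y := by linarith
  have hc1 : ρ x ≤ 2 * ρ y := by linarith
  have hc2 : ρ y ≤ 2 * ρ x := by linarith
  unfold kap
  rw [indicator_of_mem]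
  · rw [← ENNReal.ofReal_mul (by positivity)]
    apply ENNReal.ofReal_le_ofReal
    have e1 : ρ x ^ q * (1 / (ε * ρ x)) = ρ x ^ (q - 1) * (1 / ε) := by
      rw [Real.rpow_sub hρx, Real.rpow_one]; field_simp
    rw [e1]
    gcongr
    exact rpow_comparable _ hρx hρy hc1 hc2
  · refine ⟨hρy, hs.1, hs.2.trans ?_⟩
    have : ε * ρ x ≤ ε * (2 * ρ y) := by gcongr
    simp only
    linarith

theorem avg_bound {d : ℕ} {Ω : Set (Ed d)} {ρ : Ed d → ℝ} (h : GoodWeight d Ω ρ)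
    {ε : ℝ} (q p : ℝ) (hε : 0 < ε) (hε8 : ε ≤ 1 / 8) {e : Ed d} (he : ‖e‖ = 1)
    (φ : ContDiffBump (0 : Ed d)) {g : Ed d → ℝ} (hg : Measurable g) :
    ∫⁻ x in {x | φ.rOut < ε * ρ x}, ENNReal.ofReal (ρ x ^ q) * Jav φ e p (ε * ρ x) g x ≤
      ENNReal.ofReal (6 * 2 ^ |q - 1|) *
        ∫⁻ x in Ω, ENNReal.ofReal (ρ x ^ q) * ‖g x‖ₑ ^ p := by
  set η : Ed d → ℝ≥0∞ := fun t => ENNReal.ofReal (φ.normed volume t) with hη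
  have hηm : Measurable η := (φ.continuous_normed.measurable).ennreal_ofReal
  set H : Ed d → ℝ≥0∞ := fun y => ‖g y‖ₑ ^ p with hH
  have hHm : Measurable H := hg.enorm.pow_const p
  set Φ : ℝ × Ed d → ℝ≥0∞ := fun z => kap ρ ε q z * H z.2 with hΦ
  have hΦm : Measurable Φ := (kap_measurable h ε q).mul (hHm.comp measurable_snd)
  have hS : MeasurableSet {x | φ.rOut < ε * ρ x} :=
    (isOpen_lt continuous_const (continuous_const.mul h.cont)).measurableSet
  have step1 : ∫⁻ x in {x | φ.rOut < ε * ρ x}, ENNReal.ofReal (ρ x ^ q) * Jav φ e p (ε * ρ x) g x ≤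
      ∫⁻ x, ∫⁻ s : ℝ, ∫⁻ t, η t * Φ (s, x + s • e - t) := by
    refine (setLIntegral_mono' hS fun x hx => ?_).trans (setLIntegral_le_lintegral _ _)
    unfold Jav
    rw [← mul_assoc, ← lintegral_const_mul' _ _
      (ENNReal.mul_ne_top ENNReal.ofReal_ne_top ENNReal.ofReal_ne_top)]
    refine (setLIntegral_mono' measurableSet_Icc fun s hs => ?_).trans
      (setLIntegral_le_lintegral _ _)
    rw [← lintegral_const_mul' _ _
      (ENNReal.mul_ne_top ENNReal.ofReal_ne_top ENNReal.ofReal_ne_top)]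
    refine lintegral_mono fun t => ?_
    by_cases ht : ‖t‖ < φ.rOut
    · have := kap_ge h (q := q) hε hε8 he hx ht hs
      calc _ = η t * ((ENNReal.ofReal (ρ x ^ q) * ENNReal.ofReal (1 / (ε * ρ x))) *
            H (x + s • e - t)) := by simp only [hη, hH]; ring
        _ ≤ _ := by simp only [hΦ]; gcongr
    · rw [normed_zero φ (not_lt.1 ht)]; simp
  refine step1.trans ?_
  have hmeas3 : Measurable fun z : (Ed d × ℝ) × Ed d =>
      η z.2 * Φ (z.1.2, z.1.1 + z.1.2 • e - z.2) := by
    refine (hηm.comp measurable_snd).mul (hΦm.comp ?_)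
    fun_prop
  rw [lintegral_lintegral_swap]
  swap
  · exact (hmeas3.lintegral_prod_right').aemeasurable
  have step2 : ∀ s : ℝ, ∫⁻ x, ∫⁻ t, η t * Φ (s, x + s • e - t) = ∫⁻ y, Φ (s, y) := by
    intro s
    rw [lintegral_lintegral_swap]
    swap
    · refine Measurable.aemeasurable ?_
      refine (hηm.comp measurable_snd).mul (hΦm.comp ?_)
      fun_prop
    have : ∀ t, ∫⁻ x, η t * Φ (s, x + s • e - t) = η t * ∫⁻ y, Φ (s, y) := by
      intro t
      rw [lintegral_const_mul']
      · congr 1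
        have := lintegral_add_right_eq_self (μ := (volume : Measure (Ed d)))
          (fun y => Φ (s, y)) (s • e - t)
        rw [← this]
        simp only [add_sub_assoc]
      · exact ENNReal.ofReal_ne_top
    simp only [this]
    rw [lintegral_mul_const _ hηm, lint_normed, one_mul]
  simp only [step2]
  rw [lintegral_lintegral_swap]
  swap
  · exact hΦm.aemeasurable
  have step3 : ∀ y, ∫⁻ s, Φ (s, y) = Ω.indicator (fun y => ENNReal.ofReal (6 * 2 ^ |q - 1|) *
      (ENNReal.ofReal (ρ y ^ q) * H y)) y := by
    intro y
    simp only [hΦ]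
    have hkm : Measurable fun s : ℝ => kap ρ ε q (s, y) :=
      (kap_measurable h ε q).comp measurable_prodMk_right
    rw [lintegral_mul_const _ hkm, kap_lintegral h hε]
    by_cases hy : y ∈ Ω
    · rw [indicator_of_mem hy, indicator_of_mem hy, mul_assoc]
    · rw [indicator_of_notMem hy, indicator_of_notMem hy, zero_mul]
  simp only [step3]
  rw [lintegral_indicator h.isOpen_dom.measurableSet, lintegral_const_mul' _ _ ENNReal.ofReal_ne_top]


/-- bump functions -/
def bmp (d : ℕ) (n : ℕ) : ContDiffBump (0 : Ed d) where
  rIn := 1 / ((n : ℝ) + 1) / 2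
  rOut := 1 / ((n : ℝ) + 1)
  rIn_pos := by positivity
  rIn_lt_rOut := by
    have : 0 < 1 / ((n : ℝ) + 1) := by positivity
    linarith

theorem interp_meas {d : ℕ} {Ω : Set (Ed d)} {ρ : Ed d → ℝ} (h : GoodWeight d Ω ρ)
    {ε : ℝ} (b : ℝ) {p : ℝ} (hp : 1 ≤ p) (hε : 0 < ε) (hε8 : ε ≤ 1 / 8)
    {i : Fin d} {g v w : Ed d → ℝ}
    (hg : Measurable g) (hv : Measurable v) (hw : Measurable w)
    (h1 : W1 d Ω i g v) (h2 : W1 d Ω i v w) :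
    ∫⁻ x in Ω, ENNReal.ofReal (ρ x ^ ((b + 1) * p)) * ‖v x‖ₑ ^ p ≤
      ENNReal.ofReal (12 ^ p * ε ^ (-p) * (6 * 2 ^ |b * p - 1|)) *
        (∫⁻ x in Ω, ENNReal.ofReal (ρ x ^ (b * p)) * ‖g x‖ₑ ^ p) +
      ENNReal.ofReal (12 ^ p * ε ^ p * (6 * 2 ^ |(b + 2) * p - 1|)) *
        ∫⁻ x in Ω, ENNReal.ofReal (ρ x ^ ((b + 2) * p)) * ‖w x‖ₑ ^ p := by
  set R := ENNReal.ofReal (12 ^ p * ε ^ (-p) * (6 * 2 ^ |b * p - 1|)) *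
        (∫⁻ x in Ω, ENNReal.ofReal (ρ x ^ (b * p)) * ‖g x‖ₑ ^ p) +
      ENNReal.ofReal (12 ^ p * ε ^ p * (6 * 2 ^ |(b + 2) * p - 1|)) *
        ∫⁻ x in Ω, ENNReal.ofReal (ρ x ^ ((b + 2) * p)) * ‖w x‖ₑ ^ p with hR
  have hp0 : 0 ≤ p := by linarith
  set S : ℕ → Set (Ed d) := fun n => {x | (bmp d n).rOut < ε * ρ x} with hSdef
  have hS : ∀ n, MeasurableSet (S n) := fun n =>
    (isOpen_lt continuous_const (continuous_const.mul h.cont)).measurableSet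
  have hρm : ∀ c : ℝ, Measurable fun x => ENNReal.ofReal (ρ x ^ c) := fun c =>
    (h.cont.measurable.pow_const c).ennreal_ofReal
  set f : ℕ → Ed d → ℝ≥0∞ := fun n => (S n).indicator
    (fun x => ENNReal.ofReal (ρ x ^ ((b + 1) * p)) * ‖cv (bmp d n) v x‖ₑ ^ p) with hfdef
  have hfm : ∀ n, Measurable (f n) := fun n =>
    ((hρm _).mul ((cv_measurable _ hv).enorm.pow_const p)).indicator (hS n)
  set e : Ed d := EuclideanSpace.single i 1 with he
  have hen : ‖e‖ = 1 := by simp [he]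
  -- uniform bound
  have hbound : ∀ n, ∫⁻ x in Ω, f n x ≤ R := by
    intro n
    refine (setLIntegral_le_lintegral _ _).trans ?_
    simp only [hfdef]
    rw [lintegral_indicator (hS n)]
    have hpt : ∀ x ∈ S n, ENNReal.ofReal (ρ x ^ ((b + 1) * p)) * ‖cv (bmp d n) v x‖ₑ ^ p ≤
        ENNReal.ofReal (12 ^ p * ε ^ (-p)) *
          (ENNReal.ofReal (ρ x ^ (b * p)) * Jav (bmp d n) e p (ε * ρ x) g x) +
        ENNReal.ofReal (12 ^ p * ε ^ p) *
          (ENNReal.ofReal (ρ x ^ ((b + 2) * p)) * Jav (bmp d n) e p (ε * ρ x) w x) := by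
      intro x hx
      have hx' : (bmp d n).rOut < ε * ρ x := hx
      have hr : 0 < ε * ρ x := lt_trans (bmp d n).rOut_pos hx'
      have hρx : 0 < ρ x := by
        by_contra hc
        have : ε * ρ x ≤ 0 := mul_nonpos_of_nonneg_of_nonpos hε.le (not_lt.1 hc)
        linarith
      have h8 : ε * ρ x ≤ 1 / 8 * ρ x := by gcongr
      have := pointwise_est h (bmp d n) hg hw h1 h2 hp x hr (by linarith)
      refine (mul_le_mul_right this _).trans (le_of_eq ?_)
      have r1 : ENNReal.ofReal (ρ x ^ ((b + 1) * p)) * ENNReal.ofReal (12 ^ p) *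
          ENNReal.ofReal ((ε * ρ x) ^ (-p)) = ENNReal.ofReal (12 ^ p * ε ^ (-p)) *
          ENNReal.ofReal (ρ x ^ (b * p)) := by
        rw [← ENNReal.ofReal_mul (by positivity), ← ENNReal.ofReal_mul (by positivity),
          ← ENNReal.ofReal_mul (by positivity)]
        congr 1
        have : ρ x ^ (b * p) = ρ x ^ ((b + 1) * p) * ρ x ^ (-p) := by
          rw [← Real.rpow_add hρx]; congr 1; ring
        rw [this, Real.mul_rpow hε.le hρx.le]; ring
      have r2 : ENNReal.ofReal (ρ x ^ ((b + 1) * p)) * ENNReal.ofReal (12 ^ p) *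
          ENNReal.ofReal ((ε * ρ x) ^ p) = ENNReal.ofReal (12 ^ p * ε ^ p) *
          ENNReal.ofReal (ρ x ^ ((b + 2) * p)) := by
        rw [← ENNReal.ofReal_mul (by positivity), ← ENNReal.ofReal_mul (by positivity),
          ← ENNReal.ofReal_mul (by positivity)]
        congr 1
        have : ρ x ^ ((b + 2) * p) = ρ x ^ ((b + 1) * p) * ρ x ^ p := by
          rw [← Real.rpow_add hρx]; congr 1; ring
        rw [this, Real.mul_rpow hε.le hρx.le]; ring
      rw [← mul_assoc, mul_add, ← mul_assoc, ← mul_assoc, r1, r2, mul_assoc, mul_assoc]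
    refine (setLIntegral_mono' (hS n) hpt).trans ?_
    have hJm : ∀ {k : Ed d → ℝ}, Measurable k →
        Measurable fun x => Jav (bmp d n) e p (ε * ρ x) k x := by
      intro k hk
      unfold Jav
      refine Measurable.mul ?_ ?_
      · exact (measurable_const.div (h.cont.measurable.const_mul ε)).ennreal_ofReal
      · have hinner : Measurable fun z : Ed d × ℝ => ∫⁻ t,
            ENNReal.ofReal ((bmp d n).normed volume t) * ‖k (z.1 + z.2 • e - t)‖ₑ ^ p := by
          refine Measurable.lintegral_prod_right' (f := fun z : (Ed d × ℝ) × Ed d =>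
            ENNReal.ofReal ((bmp d n).normed volume z.2) * ‖k (z.1.1 + z.1.2 • e - z.2)‖ₑ ^ p) ?_
          refine Measurable.mul ?_ ?_
          · exact ((bmp d n).continuous_normed.measurable.comp measurable_snd).ennreal_ofReal
          · exact ((hk.comp (by fun_prop)).enorm).pow_const p
        have hset : MeasurableSet {z : Ed d × ℝ | z.2 ∈ Icc 0 (3 * (ε * ρ z.1))} := by
          refine MeasurableSet.inter (measurableSet_le measurable_const measurable_snd) ?_
          exact measurableSet_le measurable_snd
            (((h.cont.measurable.comp measurable_fst).const_mul ε).const_mul 3)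
        have := (hinner.indicator hset).lintegral_prod_right' (ν := volume)
        convert this using 1
        ext x
        rw [← lintegral_indicator measurableSet_Icc]
        rfl
    rw [lintegral_add_left]
    swap
    · exact ((hρm _).mul (hJm hg)).const_mul _
    rw [lintegral_const_mul' _ _ ENNReal.ofReal_ne_top,
      lintegral_const_mul' _ _ ENNReal.ofReal_ne_top, hR]
    refine add_le_add ?_ ?_
    · rw [ENNReal.ofReal_mul (q := 6 * _) (by positivity), mul_assoc]
      exact mul_le_mul_right (avg_bound h (b * p) p hε hε8 hen _ hg) _
    · rw [ENNReal.ofReal_mul (q := 6 * _) (by positivity), mul_assoc]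
      exact mul_le_mul_right (avg_bound h ((b + 2) * p) p hε hε8 hen _ hw) _
  -- convergence
  have h0 : Tendsto (fun n => (bmp d n).rOut) atTop (𝓝 0) := tendsto_one_div_add_atTop_nhds_zero_nat
  have hlim : ∀ᵐ x ∂(volume.restrict Ω),
      ENNReal.ofReal (ρ x ^ ((b + 1) * p)) * ‖v x‖ₑ ^ p = liminf (fun n => f n x) atTop := by
    refine (ae_restrict_iff' h.isOpen_dom.measurableSet).2 ?_
    filter_upwards [cv_tendsto h h1.2.1 (bmp d) h0
      (fun n => by simp only [bmp]; linarith)] with x hx hxΩ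
    have hρx := (h.mem x).1 hxΩ
    have hev : ∀ᶠ n in atTop, x ∈ S n := h0.eventually (gt_mem_nhds (by positivity))
    have ht : Tendsto (fun n => f n x) atTop
        (𝓝 (ENNReal.ofReal (ρ x ^ ((b + 1) * p)) * ‖v x‖ₑ ^ p)) := by
      have h3 : Tendsto (fun n => ENNReal.ofReal (ρ x ^ ((b + 1) * p)) * ‖cv (bmp d n) v x‖ₑ ^ p)
          atTop (𝓝 (ENNReal.ofReal (ρ x ^ ((b + 1) * p)) * ‖v x‖ₑ ^ p)) := by
        refine ENNReal.Tendsto.const_mul ?_ (Or.inr ENNReal.ofReal_ne_top)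
        exact (ENNReal.continuous_rpow_const.tendsto _).comp (hx hxΩ).enorm
      refine h3.congr' ?_
      filter_upwards [hev] with n hn
      simp only [hfdef]
      rw [indicator_of_mem hn]
    exact ht.liminf_eq.symm
  rw [lintegral_congr_ae hlim]
  refine (lintegral_liminf_le hfm).trans ?_
  refine (liminf_le_liminf (Eventually.of_forall hbound)).trans ?_
  simp

theorem interp_gen {d : ℕ} {Ω : Set (Ed d)} {ρ : Ed d → ℝ} (h : GoodWeight d Ω ρ)
    {ε : ℝ} (b : ℝ) {p : ℝ} (hp : 1 ≤ p) (hε : 0 < ε) (hε8 : ε ≤ 1 / 8)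
    {i : Fin d} {g v w : Ed d → ℝ}
    (h1 : W1 d Ω i g v) (h2 : W1 d Ω i v w) :
    ∫⁻ x in Ω, ENNReal.ofReal (ρ x ^ ((b + 1) * p)) * ‖v x‖ₑ ^ p ≤
      ENNReal.ofReal (12 ^ p * ε ^ (-p) * (6 * 2 ^ |b * p - 1|)) *
        (∫⁻ x in Ω, ENNReal.ofReal (ρ x ^ (b * p)) * ‖g x‖ₑ ^ p) +
      ENNReal.ofReal (12 ^ p * ε ^ p * (6 * 2 ^ |(b + 2) * p - 1|)) *
        ∫⁻ x in Ω, ENNReal.ofReal (ρ x ^ ((b + 2) * p)) * ‖w x‖ₑ ^ p := by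
  have hm : ∀ {f : Ed d → ℝ}, LocallyIntegrableOn f Ω volume →
      ∃ f' : Ed d → ℝ, Measurable f' ∧ f =ᵐ[volume.restrict Ω] f' := by
    intro f hf
    exact hf.aestronglyMeasurable.aemeasurable
  have hc : ∀ {f f' : Ed d → ℝ} (c : ℝ), f =ᵐ[volume.restrict Ω] f' →
      ∫⁻ x in Ω, ENNReal.ofReal (ρ x ^ c) * ‖f x‖ₑ ^ p =
      ∫⁻ x in Ω, ENNReal.ofReal (ρ x ^ c) * ‖f' x‖ₑ ^ p := by
    intro f f' c hff
    exact lintegral_congr_ae (hff.mono fun x hx => by simp only [hx])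
  obtain ⟨g', hg', eg⟩ := hm h1.1
  obtain ⟨v', hv', ev⟩ := hm h1.2.1
  obtain ⟨w', hw', ew⟩ := hm h2.2.1
  rw [hc _ eg, hc _ ev, hc _ ew]
  exact interp_meas h b hp hε hε8 hg' hv' hw' (W1_congr i h.isOpen_dom h1 eg ev)
    (W1_congr i h.isOpen_dom h2 ev ew)


/-- Nonnegative sequences satisfying the interpolation inequality. -/
def GoodSeq (m : ℕ) (C t₀ : ℝ) (S : ℕ → ℝ) : Prop :=
  (∀ j, 0 ≤ S j) ∧ ∀ j, j + 2 ≤ m → ∀ t, 0 < t → t ≤ t₀ →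
    S (j + 1) ≤ C * (t⁻¹ * S j + t * S (j + 2))

theorem seq_step (m : ℕ) {C t₀ : ℝ} (hC : 0 < C) (ht₀ : 0 < t₀) (k : ℕ) (hk : k + 1 ≤ m) :
    ∀ δ : ℝ, 0 < δ → ∃ K : ℝ, 0 ≤ K ∧ ∀ S, GoodSeq m C t₀ S →
      S k ≤ δ * S (k + 1) + K * S 0 := by
  induction k with
  | zero =>
    intro δ hδ
    refine ⟨1, zero_le_one, fun S hS => ?_⟩
    have := mul_nonneg hδ.le (hS.1 (0 + 1))
    linarith
  | succ k ih =>
    intro δ hδ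
    set t := min t₀ (δ / (2 * C)) with ht
    have ht0 : 0 < t := lt_min ht₀ (by positivity)
    obtain ⟨K, hK0, hK⟩ := ih (by omega) (t / (2 * C)) (by positivity)
    refine ⟨2 * C * t⁻¹ * K, by positivity, fun S hS => ?_⟩
    have h1 := hS.2 k (by omega) t ht0 (min_le_left _ _)
    have h2 := hK S hS
    have h3 : C * t ≤ δ / 2 := by
      calc C * t ≤ C * (δ / (2 * C)) := by gcongr; exact min_le_right _ _
        _ = δ / 2 := by field_simp
    have h4 : C * t * S (k + 2) ≤ δ / 2 * S (k + 2) := by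
      have := hS.1 (k + 2)
      gcongr
    have h5 : C * t⁻¹ * S k ≤ C * t⁻¹ * (t / (2 * C) * S (k + 1) + K * S 0) := by gcongr
    have h6 : C * t⁻¹ * (t / (2 * C) * S (k + 1) + K * S 0) =
        S (k + 1) / 2 + C * t⁻¹ * K * S 0 := by field_simp
    have h7 : S (k + 1 + 1) = S (k + 2) := rfl
    rw [h7]
    nlinarith

theorem seq_lower (m : ℕ) {C t₀ : ℝ} (hC : 0 < C) (ht₀ : 0 < t₀) (i : ℕ) :
    ∃ K : ℝ, 0 ≤ K ∧ ∀ S, GoodSeq m C t₀ S → S (m - i) ≤ S m + K * S 0 := by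
  induction i with
  | zero => exact ⟨0, le_rfl, fun S _ => by simp⟩
  | succ i ih =>
    by_cases hi : i + 1 ≤ m
    · obtain ⟨K, hK0, hK⟩ := ih
      obtain ⟨K', hK0', hK'⟩ := seq_step m hC ht₀ (m - (i + 1)) (by omega) 1 one_pos
      refine ⟨K + K', by positivity, fun S hS => ?_⟩
      have h1 := hK S hS
      have h2 := hK' S hS
      have h3 : m - (i + 1) + 1 = m - i := by omega
      rw [h3] at h2
      linarith
    · obtain ⟨K, hK0, hK⟩ := ih
      refine ⟨K, hK0, fun S hS => ?_⟩
      have : m - (i + 1) = m - i := by omega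
      rw [this]; exact hK S hS

theorem seq_total (m : ℕ) {C t₀ : ℝ} (hC : 0 < C) (ht₀ : 0 < t₀) :
    ∃ K : ℝ, 0 ≤ K ∧ ∀ S, GoodSeq m C t₀ S →
      ∑ j ∈ Finset.range (m + 1), S j ≤ K * (S 0 + S m) := by
  choose K hK0 hK using seq_lower m hC ht₀
  refine ⟨∑ j ∈ Finset.range (m + 1), (1 + K (m - j)),
    Finset.sum_nonneg fun j _ => by linarith [hK0 (m - j)], fun S hS => ?_⟩
  rw [Finset.sum_mul]
  refine Finset.sum_le_sum fun j hj => ?_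
  have hj' : j ≤ m := by simpa [Nat.lt_succ_iff] using hj
  have h1 := hK (m - j) S hS
  rw [Nat.sub_sub_self hj'] at h1
  have := hS.1 0
  have := hS.1 m
  have := hK0 (m - j)
  nlinarith [mul_nonneg (hK0 (m - j)) (hS.1 m)]


theorem goodWeight_model (d ℓ : ℕ) : GoodWeight d (ModelDomain d ℓ) (rhoModel d ℓ) := by
  set P : Ed d → Ed d := fun x => WithLp.toLp 2 (fun i => if (i : ℕ) < d - ℓ then x i else 0)
    with hP
  have hσ : ∀ x : Ed d, Real.sqrt (∑ i ∈ Finset.univ.filter (fun i : Fin d => (i : ℕ) < d - ℓ),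
      (x i) ^ 2) = ‖P x‖ := by
    intro x
    rw [EuclideanSpace.norm_eq, Finset.sum_filter]
    congr 1
    refine Finset.sum_congr rfl fun i _ => ?_
    simp only [hP]
    split_ifs <;> simp
  have hρ : ∀ x, rhoModel d ℓ x = min 1 ‖P x‖ := fun x => by rw [rhoModel, hσ]
  have hPle : ∀ x, ‖P x‖ ≤ ‖x‖ := by
    intro x
    rw [EuclideanSpace.norm_eq, EuclideanSpace.norm_eq]
    refine Real.sqrt_le_sqrt (Finset.sum_le_sum fun i _ => ?_)
    simp only [hP]
    split_ifs
    · exact le_rfl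
    · simp; positivity
  have hPsub : ∀ x y, P x = P y + P (x - y) := by
    intro x y
    ext i
    simp only [hP, PiLp.add_apply, PiLp.sub_apply]
    split_ifs <;> simp
  refine ⟨fun x => ?_, fun x y => ?_, fun x => ?_⟩
  · rw [hρ]; positivity
  · rw [hρ, hρ]
    have h1 : ‖P x‖ ≤ ‖P y‖ + ‖x - y‖ := by
      rw [hPsub x y]
      exact (norm_add_le _ _).trans (by gcongr; exact hPle _)
    have h2 := norm_nonneg (x - y)
    rcases min_choice 1 ‖P y‖ with h | h
    · rw [h]; exact (min_le_left _ _).trans (by linarith)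
    · rw [h]; exact (min_le_right _ _).trans h1
  · rw [hρ]
    simp only [lt_min_iff, zero_lt_one, true_and, norm_pos_iff]
    simp only [ModelDomain, RStar, mem_compl_iff, mem_ofPred_eq]
    refine not_congr ⟨fun h => ?_, fun h i hi => ?_⟩
    · ext i
      simp only [hP]
      split_ifs with hi
      · simpa using h i hi
      · simp
    · have := congrArg (fun z : Ed d => z i) h
      simpa [hP, hi] using this


theorem mem_multiIdx {d m : ℕ} (α : Fin d → ℕ) : α ∈ multiIdx d m ↔ ∑ i, α i ≤ m := by
  unfold multiIdx
  simp only [Finset.mem_filter, Fintype.mem_piFinset, Finset.mem_range, and_iff_right_iff_imp]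
  intro h i
  have := Finset.single_le_sum (f := α) (fun _ _ => Nat.zero_le _) (Finset.mem_univ i)
  omega

theorem kI_nonneg {d : ℕ} {Ω : Set (Ed d)} {ρ : Ed d → ℝ} (h : GoodWeight d Ω ρ) (a p : ℝ)
    (α : Fin d → ℕ) (v : Ed d → ℝ) (x : Ed d) : 0 ≤ kIntegrand d ρ a p α v x := by
  have := h.nonneg x
  unfold kIntegrand
  positivity

theorem kI_lint {d : ℕ} {Ω : Set (Ed d)} {ρ : Ed d → ℝ} (h : GoodWeight d Ω ρ) (a : ℝ) {p : ℝ}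
    (hp : 1 ≤ p) (α : Fin d → ℕ) (v : Ed d → ℝ)
    (hi : IntegrableOn (kIntegrand d ρ a p α v) Ω volume) :
    ∫⁻ x in Ω, ENNReal.ofReal (ρ x ^ ((((∑ i, α i : ℕ) : ℝ) - a) * p)) * ‖v x‖ₑ ^ p =
      ENNReal.ofReal (∫ x in Ω, kIntegrand d ρ a p α v x) := by
  rw [ofReal_integral_eq_lintegral_ofReal hi (Eventually.of_forall fun x => kI_nonneg h a p α v x)]
  refine setLIntegral_congr_fun h.isOpen_dom.measurableSet fun x hx => ?_
  have hρ := (h.mem x).1 hx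
  simp only [kIntegrand]
  rw [Real.mul_rpow (by positivity) (by positivity), ← Real.rpow_mul hρ.le,
    ENNReal.ofReal_mul (by positivity), ← ENNReal.ofReal_rpow_of_nonneg (abs_nonneg _) (by linarith),
    ← Real.norm_eq_abs, ofReal_norm]

/-- The constant in the interpolation inequality. -/
def cst (a p : ℝ) (j : ℕ) : ℝ := 12 ^ p * (6 * 2 ^ |((j : ℝ) - a) * p - 1|)

theorem cst_pos (a p : ℝ) (j : ℕ) : 0 < cst a p j := by unfold cst; positivity

theorem sum_add_single {d : ℕ} (α : Fin d → ℕ) (i : Fin d) :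
    ∑ k, (α + Pi.single i 1 : Fin d → ℕ) k = (∑ k, α k) + 1 := by
  simp [Finset.sum_add_distrib]

theorem interp_real {d m : ℕ} {Ω : Set (Ed d)} {ρ : Ed d → ℝ} (h : GoodWeight d Ω ρ)
    (a : ℝ) {p : ℝ} (hp : 1 ≤ p) {u : Ed d → ℝ} {D : (Fin d → ℕ) → Ed d → ℝ}
    (hD : KMemData d Ω ρ m a p u D) (α : Fin d → ℕ) (i : Fin d) (hα : ∑ k, α k + 2 ≤ m)
    {t : ℝ} (ht : 0 < t) (ht8 : t ≤ (1 / 8) ^ p) :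
    ∫ x in Ω, kIntegrand d ρ a p (α + Pi.single i 1) (D (α + Pi.single i 1)) x ≤
      (∑ j ∈ Finset.range (m + 1), cst a p j) * (t⁻¹ * (∫ x in Ω, kIntegrand d ρ a p α (D α) x) +
        t * ∫ x in Ω, kIntegrand d ρ a p (α + Pi.single i 1 + Pi.single i 1)
          (D (α + Pi.single i 1 + Pi.single i 1)) x) := by
  set α1 := α + Pi.single i 1 with hα1
  set α2 := α1 + Pi.single i 1 with hα2
  have s1 : ∑ k, α1 k = ∑ k, α k + 1 := sum_add_single α i
  have s2 : ∑ k, α2 k = ∑ k, α k + 2 := by rw [hα2, sum_add_single, s1]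
  have m0 : α ∈ multiIdx d m := (mem_multiIdx _).2 (by omega)
  have m1 : α1 ∈ multiIdx d m := (mem_multiIdx _).2 (by omega)
  have m2 : α2 ∈ multiIdx d m := (mem_multiIdx _).2 (by omega)
  have w1 := W1_of_weak i α (hD.1 α m0) (hD.1 α1 m1)
  have w2 := W1_of_weak i α1 (hD.1 α1 m1) (hD.1 α2 m2)
  have hp0 : 0 < p := by linarith
  have hε : 0 < t ^ (1 / p) := by positivity
  have hε8 : t ^ (1 / p) ≤ 1 / 8 := by
    calc t ^ (1 / p) ≤ ((1 / 8) ^ p) ^ (1 / p) := by gcongr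
      _ = 1 / 8 := by
        rw [← Real.rpow_mul (by norm_num), mul_one_div_cancel hp0.ne', Real.rpow_one]
  have key := interp_gen h (((∑ k, α k : ℕ) : ℝ) - a) hp hε hε8 w1 w2
  have e1 : (((∑ k, α k : ℕ) : ℝ) - a) + 1 = ((∑ k, α1 k : ℕ) : ℝ) - a := by
    rw [s1]; push_cast; ring
  have e2 : (((∑ k, α k : ℕ) : ℝ) - a) + 2 = ((∑ k, α2 k : ℕ) : ℝ) - a := by
    rw [s2]; push_cast; ring
  have e3 : (t ^ (1 / p)) ^ p = t := by
    rw [← Real.rpow_mul ht.le, one_div_mul_cancel hp0.ne', Real.rpow_one]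
  have e4 : (t ^ (1 / p)) ^ (-p) = t⁻¹ := by rw [Real.rpow_neg hε.le, e3]
  have nn : ∀ β, 0 ≤ ∫ x in Ω, kIntegrand d ρ a p β (D β) x := fun β =>
    integral_nonneg fun x => kI_nonneg h a p β _ x
  rw [e1, e2, kI_lint h a hp α1 _ (hD.2 α1 m1), kI_lint h a hp α _ (hD.2 α m0),
    kI_lint h a hp α2 _ (hD.2 α2 m2), e3, e4, ← ENNReal.ofReal_mul (by positivity),
    ← ENNReal.ofReal_mul (by positivity), ← ENNReal.ofReal_add
      (mul_nonneg (by positivity) (nn _)) (mul_nonneg (by positivity) (nn _)),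
    ENNReal.ofReal_le_ofReal_iff (add_nonneg (mul_nonneg (by positivity) (nn _))
      (mul_nonneg (by positivity) (nn _)))] at key
  have c1 : cst a p (∑ k, α k) ≤ ∑ j ∈ Finset.range (m + 1), cst a p j :=
    Finset.single_le_sum (f := cst a p) (fun j _ => (cst_pos a p j).le)
      (Finset.mem_range.2 (by omega))
  have c2 : cst a p (∑ k, α2 k) ≤ ∑ j ∈ Finset.range (m + 1), cst a p j :=
    Finset.single_le_sum (f := cst a p) (fun j _ => (cst_pos a p j).le)
      (Finset.mem_range.2 (by omega))
  refine key.trans ?_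
  have i0 := nn α
  have i2 := nn α2
  rw [mul_add]
  refine add_le_add ?_ ?_
  · calc _ = cst a p (∑ k, α k) * (t⁻¹ * ∫ x in Ω, kIntegrand d ρ a p α (D α) x) := by
          unfold cst; ring
      _ ≤ _ := by gcongr
  · calc _ = cst a p (∑ k, α2 k) * (t * ∫ x in Ω, kIntegrand d ρ a p α2 (D α2) x) := by
          unfold cst; ring
      _ ≤ _ := by gcongr

/-- Sum of the integrals over all multi-indices of order `j`. -/
def SS (d : ℕ) (Ω : Set (Ed d)) (ρ : Ed d → ℝ) (m : ℕ) (a p : ℝ)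
    (D : (Fin d → ℕ) → Ed d → ℝ) (j : ℕ) : ℝ :=
  ∑ α ∈ (multiIdx d m).filter (fun α => ∑ i, α i = j), ∫ x in Ω, kIntegrand d ρ a p α (D α) x

theorem SS_good {d m : ℕ} {Ω : Set (Ed d)} {ρ : Ed d → ℝ} (h : GoodWeight d Ω ρ)
    (a : ℝ) {p : ℝ} (hp : 1 ≤ p) {u : Ed d → ℝ} {D : (Fin d → ℕ) → Ed d → ℝ}
    (hD : KMemData d Ω ρ m a p u D) :
    GoodSeq m ((multiIdx d m).card * ∑ j ∈ Finset.range (m + 1), cst a p j) ((1 / 8) ^ p)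
      (SS d Ω ρ m a p D) := by
  have nn : ∀ β, 0 ≤ ∫ x in Ω, kIntegrand d ρ a p β (D β) x := fun β =>
    integral_nonneg fun x => kI_nonneg h a p β _ x
  have hS0 : ∀ j, 0 ≤ SS d Ω ρ m a p D j := fun j => Finset.sum_nonneg fun β _ => nn β
  refine ⟨hS0, fun j hj t ht ht8 => ?_⟩
  have hle : ∀ (β : Fin d → ℕ) (k : ℕ), ∑ i, β i = k → k ≤ m →
      ∫ x in Ω, kIntegrand d ρ a p β (D β) x ≤ SS d Ω ρ m a p D k := by
    intro β k hβ hk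
    exact Finset.single_le_sum (f := fun β => ∫ x in Ω, kIntegrand d ρ a p β (D β) x)
      (fun β _ => nn β) (Finset.mem_filter.2 ⟨(mem_multiIdx _).2 (by omega), hβ⟩)
  have hcs : 0 ≤ ∑ j ∈ Finset.range (m + 1), cst a p j :=
    Finset.sum_nonneg fun j _ => (cst_pos a p j).le
  set T := (∑ j ∈ Finset.range (m + 1), cst a p j) *
    (t⁻¹ * SS d Ω ρ m a p D j + t * SS d Ω ρ m a p D (j + 2)) with hT
  have hT0 : 0 ≤ T := by
    have := hS0 j
    have := hS0 (j + 2)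
    positivity
  have hterm : ∀ β ∈ (multiIdx d m).filter (fun α => ∑ i, α i = j + 1),
      ∫ x in Ω, kIntegrand d ρ a p β (D β) x ≤ T := by
    intro β hβ
    have hβs := (Finset.mem_filter.1 hβ).2
    obtain ⟨i, hi⟩ : ∃ i, β i ≠ 0 := by
      by_contra hc
      push Not at hc
      simp [hc] at hβs
    set α : Fin d → ℕ := β - Pi.single i 1 with hαd
    have hβα : β = α + Pi.single i 1 := by
      ext k
      simp only [hαd, Pi.add_apply, Pi.sub_apply]
      by_cases hk : k = i
      · subst hk; simp; omega
      · simp [hk]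
    have hαs : ∑ k, α k = j := by
      have := sum_add_single α i
      rw [← hβα] at this
      omega
    have := interp_real h a hp hD α i (by omega) ht ht8
    rw [hβα]
    refine this.trans ?_
    rw [hT]
    have l1 := hle α j hαs (by omega)
    have l2 := hle (α + Pi.single i 1 + Pi.single i 1) (j + 2)
      (by rw [sum_add_single, sum_add_single]; omega) hj
    gcongr
  calc SS d Ω ρ m a p D (j + 1) ≤ ∑ β ∈ (multiIdx d m).filter (fun α => ∑ i, α i = j + 1), T :=
        Finset.sum_le_sum hterm
    _ = (((multiIdx d m).filter (fun α => ∑ i, α i = j + 1)).card : ℝ) * T := by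
        rw [Finset.sum_const, nsmul_eq_mul]
    _ ≤ ((multiIdx d m).card : ℝ) * T := by
        gcongr
        exact Finset.filter_subset _ _
    _ = _ := by rw [hT]; ring

theorem SS_total {d m : ℕ} (Ω : Set (Ed d)) (ρ : Ed d → ℝ) (a p : ℝ)
    (D : (Fin d → ℕ) → Ed d → ℝ) :
    ∑ j ∈ Finset.range (m + 1), SS d Ω ρ m a p D j =
      ∑ α ∈ multiIdx d m, ∫ x in Ω, kIntegrand d ρ a p α (D α) x := by
  unfold SS
  refine Finset.sum_fiberwise_of_maps_to (fun α hα => ?_) _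
  have := (mem_multiIdx α).1 hα
  exact Finset.mem_range.2 (by omega)

/-- Proposition `hilfe`: for `1 ≤ p < ∞`, `m ∈ ℕ`, `a ∈ ℝ`, `0 ≤ ℓ < d`, the norm
`‖u‖_* = ‖ρ^{-a}u|L_p‖ + ∑_{|α|=m}‖ρ^{m-a}∂^α u|L_p‖` is an equivalent norm on
`𝒦^m_{a,p}(ℝ^d, ℝ^ℓ_*)`. -/
theorem statement2 (d ℓ m : ℕ) (hd : 2 ≤ d) (hl : ℓ < d) (hm : 1 ≤ m)
    (a p : ℝ) (hp : 1 ≤ p) :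
    ∃ c₁ c₂ : ℝ, 0 < c₁ ∧ c₁ ≤ c₂ ∧
      ∀ (u : Ed d → ℝ) (D : (Fin d → ℕ) → Ed d → ℝ),
        KMemData d (ModelDomain d ℓ) (rhoModel d ℓ) m a p u D →
          c₁ * KnormP d (ModelDomain d ℓ) (rhoModel d ℓ) m a p D ≤
              KnormStarP d (ModelDomain d ℓ) (rhoModel d ℓ) m a p u D ∧
            KnormStarP d (ModelDomain d ℓ) (rhoModel d ℓ) m a p u D ≤
              c₂ * KnormP d (ModelDomain d ℓ) (rhoModel d ℓ) m a p D := by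
  have h := goodWeight_model d ℓ
  set Ω := ModelDomain d ℓ with hΩ
  set ρ := rhoModel d ℓ with hρ
  have hp0 : 0 < p := by linarith
  set M : ℝ := ((multiIdx d m).card : ℝ) with hM
  have hcard : 0 < (multiIdx d m).card :=
    Finset.card_pos.2 ⟨0, (mem_multiIdx _).2 (by simp)⟩
  have hM0 : 0 < M := by rw [hM]; exact_mod_cast hcard
  have hcs : 0 < ∑ j ∈ Finset.range (m + 1), cst a p j :=
    Finset.sum_pos (fun j _ => cst_pos a p j) ⟨0, by simp⟩
  obtain ⟨K, hK0, hK⟩ := seq_total m (mul_pos hM0 hcs) (t₀ := (1 / 8) ^ p) (by positivity)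
  set Q : ℝ := (K * (2 * M)) ^ (1 / p) with hQ
  have hQ0 : 0 ≤ Q := by positivity
  refine ⟨1 / (1 + Q), 1 + M, by positivity, ?_, fun u D hD => ?_⟩
  · have : 1 / (1 + Q) ≤ 1 := by
      rw [div_le_one (by positivity)]; linarith
    linarith
  set I : (Fin d → ℕ) → ℝ := fun β => ∫ x in Ω, kIntegrand d ρ a p β (D β) x with hI
  have nn : ∀ β, 0 ≤ I β := fun β => integral_nonneg fun x => kI_nonneg h a p β _ x
  have hKn : KnormP d Ω ρ m a p D = (∑ α ∈ multiIdx d m, I α) ^ (1 / p) := rfl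
  have hKn0 : 0 ≤ KnormP d Ω ρ m a p D := by
    rw [hKn]; exact Real.rpow_nonneg (Finset.sum_nonneg fun β _ => nn β) _
  have hu : ∫ x in Ω, (ρ x ^ (-a) * |u x|) ^ p = I 0 := by
    have hae := weak_zero_ae h.isOpen_dom (hD.1 0 ((mem_multiIdx _).2 (by simp)))
    refine integral_congr_ae (hae.mono fun x hx => ?_)
    simp [kIntegrand, hx]
  have htop : ∀ α ∈ (multiIdx d m).filter (fun α => ∑ i, α i = m),
      ∫ x in Ω, (ρ x ^ ((m : ℝ) - a) * |D α x|) ^ p = I α := by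
    intro α hα
    have := (Finset.mem_filter.1 hα).2
    simp only [hI, kIntegrand, this]
  have hst : KnormStarP d Ω ρ m a p u D = (I 0) ^ (1 / p) +
      ∑ α ∈ (multiIdx d m).filter (fun α => ∑ i, α i = m), (I α) ^ (1 / p) := by
    unfold KnormStarP
    rw [hu]
    congr 1
    exact Finset.sum_congr rfl fun α hα => by rw [htop α hα]
  have nnp : ∀ β, 0 ≤ (I β) ^ (1 / p) := fun β => Real.rpow_nonneg (nn β) _
  have hst0 : 0 ≤ KnormStarP d Ω ρ m a p u D := by
    rw [hst]; exact add_nonneg (nnp 0) (Finset.sum_nonneg fun β _ => nnp β)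
  constructor
  · set X := KnormStarP d Ω ρ m a p u D with hX
    have hpw : ∀ β, (I β) ^ (1 / p) ≤ X → I β ≤ X ^ p := by
      intro β hβ
      calc I β = ((I β) ^ (1 / p)) ^ p := by
            rw [← Real.rpow_mul (nn β), one_div_mul_cancel hp0.ne', Real.rpow_one]
        _ ≤ X ^ p := Real.rpow_le_rpow (nnp β) hβ hp0.le
    have hb0 : I 0 ≤ X ^ p := by
      apply hpw
      rw [hst]
      linarith [Finset.sum_nonneg (s := (multiIdx d m).filter (fun α => ∑ i, α i = m))
        fun β _ => nnp β]
    have hbm : ∀ α ∈ (multiIdx d m).filter (fun α => ∑ i, α i = m), I α ≤ X ^ p := by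
      intro α hα
      apply hpw
      rw [hst]
      have := Finset.single_le_sum (f := fun β => (I β) ^ (1 / p)) (fun β _ => nnp β) hα
      linarith [nnp 0]
    have hXp : 0 ≤ X ^ p := Real.rpow_nonneg hst0 _
    have hSS : ∀ k, (∀ α ∈ (multiIdx d m).filter (fun α => ∑ i, α i = k), I α ≤ X ^ p) →
        SS d Ω ρ m a p D k ≤ M * X ^ p := by
      intro k hk
      calc SS d Ω ρ m a p D k ≤ ∑ β ∈ (multiIdx d m).filter (fun α => ∑ i, α i = k), X ^ p :=
            Finset.sum_le_sum hk
        _ = (((multiIdx d m).filter (fun α => ∑ i, α i = k)).card : ℝ) * X ^ p := by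
            rw [Finset.sum_const, nsmul_eq_mul]
        _ ≤ M * X ^ p := by
            rw [hM]
            gcongr
            exact Finset.filter_subset _ _
    have hS0 : SS d Ω ρ m a p D 0 ≤ M * X ^ p := by
      apply hSS
      intro α hα
      have h0 := (Finset.mem_filter.1 hα).2
      have : α = 0 := by
        ext i
        exact (Finset.sum_eq_zero_iff.1 h0) i (Finset.mem_univ i)
      rw [this]; exact hb0
    have hSm := hSS m hbm
    have hmain := hK _ (SS_good h a hp hD)
    rw [SS_total] at hmain
    have hfin : KnormP d Ω ρ m a p D ≤ Q * X := by
      rw [hKn]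
      calc (∑ α ∈ multiIdx d m, I α) ^ (1 / p) ≤ (K * (2 * M) * X ^ p) ^ (1 / p) := by
            refine Real.rpow_le_rpow (Finset.sum_nonneg fun β _ => nn β) ?_ (by positivity)
            refine hmain.trans ?_
            rw [mul_assoc]
            exact mul_le_mul_of_nonneg_left (by linarith) hK0
        _ = Q * X := by
            rw [Real.mul_rpow (by positivity) hXp, ← Real.rpow_mul hst0,
              mul_one_div_cancel hp0.ne', Real.rpow_one]
    rw [one_div, inv_mul_le_iff₀ (by positivity)]
    linarith
  · have hle : ∀ β ∈ multiIdx d m, (I β) ^ (1 / p) ≤ KnormP d Ω ρ m a p D := by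
      intro β hβ
      rw [hKn]
      exact Real.rpow_le_rpow (nn β)
        (Finset.single_le_sum (f := I) (fun β _ => nn β) hβ) (by positivity)
    rw [hst, add_mul, one_mul]
    refine add_le_add (hle 0 ((mem_multiIdx _).2 (by simp))) ?_
    calc ∑ α ∈ (multiIdx d m).filter (fun α => ∑ i, α i = m), (I α) ^ (1 / p)
        ≤ ∑ α ∈ (multiIdx d m).filter (fun α => ∑ i, α i = m), KnormP d Ω ρ m a p D :=
          Finset.sum_le_sum fun α hα => hle α (Finset.mem_filter.1 hα).1
      _ = (((multiIdx d m).filter (fun α => ∑ i, α i = m)).card : ℝ) *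
            KnormP d Ω ρ m a p D := by rw [Finset.sum_const, nsmul_eq_mul]
      _ ≤ M * KnormP d Ω ρ m a p D := by
          rw [hM]
          gcongr
          exact Finset.filter_subset _ _


end
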